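/- arXiv:math/0502269 — 2 statements merged into one kernel-verified Lean document; each statement's English description precedes it below -/
import Mathlib

section
/- If (W,S) is a Coxeter system such that m(s,t) is even for all distinct s,t ∈ S (that is, (W,S) is even; here m(s,t) = ∞ is allowed), then (W,S) is reflection rigid. -/
/-!
In Mathlib's `CoxeterMatrix`, the entry `M i j : ℕ` is the order of `s i * s j`,
with `0` encoding the order `∞` (so `Even (M i j)` means that the order is even or `∞`).
-/

universe u v w

/-- `(W, S)` is reflection rigid: for every Coxeter system `(W, S')` on the same group `W`
whose set of reflections coincides with that of `(W, S)`, there is a bijection `ψ : S → S'`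
with `m (s, t) = m' (ψ s, ψ t)` for all `s, t ∈ S`. -/
def CoxeterSystem.ReflectionRigid {B : Type u} {W : Type w} [Group W] {M : CoxeterMatrix B}
    (cs : CoxeterSystem M W) : Prop :=
  ∀ (B' : Type v) (_ : Finite B') (M' : CoxeterMatrix B') (cs' : CoxeterSystem M' W),
    (∀ w : W, cs.IsReflection w ↔ cs'.IsReflection w) →
    ∃ ψ : B ≃ B', ∀ i j : B, M i j = M' (ψ i) (ψ j)

open Polynomial.Chebyshev in
lemma aux_refl_pow {V : Type*} [AddCommGroup V] [Module ℝ V] {x y : V} {f g : Module.Dual ℝ V}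
    (hf : f x = 2) (hg : g y = 2) (m : ℕ) (hm : m ≠ 1)
    (hfy : f y = -2 * Real.cos (Real.pi / m)) (hgx : g x = -2 * Real.cos (Real.pi / m)) :
    (Module.reflection hf * Module.reflection hg) ^ m = 1 := by
  rcases Nat.eq_zero_or_pos m with rfl | hpos
  · simp
  by_cases h2 : m = 2
  · subst h2
    have hc : Real.cos (Real.pi / (2 : ℕ)) = 0 := by simp
    rw [hc] at hfy hgx
    ext z
    rw [pow_two]
    simp only [LinearEquiv.mul_apply, Module.reflection_apply, map_sub, map_smul, hf, hg, hfy, hgx,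
      LinearEquiv.coe_one, id]
    simp
    try module
  have h3 : 3 ≤ m := by omega
  have hm0 : (m : ℝ) ≠ 0 := by positivity
  set θ : ℝ := 2 * Real.pi / m with hθ
  have hmθ : m * θ = 2 * Real.pi := by rw [hθ]; field_simp
  have ht : 2 * Real.cos θ = f y * g x - 2 := by
    rw [hfy, hgx, hθ, mul_div_assoc, Real.cos_two_mul]; ring
  have hsin : Real.sin θ ≠ 0 := by
    apply ne_of_gt
    apply Real.sin_pos_of_pos_of_lt_pi
    · rw [hθ]; positivity
    · rw [hθ, div_lt_iff₀ (by positivity)]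
      have : (3 : ℝ) ≤ m := by exact_mod_cast h3
      nlinarith [Real.pi_pos]
  ext z
  rw [Module.reflection_mul_reflection_pow_apply hf hg m z (2 * Real.cos θ) ht]
  rcases Nat.even_or_odd' m with ⟨k, hk | hk⟩
  · have e1 : ((m : ℤ) - 2) / 2 = (k : ℤ) - 1 := by omega
    have e2 : ((m : ℤ) - 1) / 2 = (k : ℤ) - 1 := by omega
    have hz : (S ℝ ((k : ℤ) - 1)).eval (2 * Real.cos θ) = 0 := by
      have := S_two_mul_real_cos θ ((k : ℤ) - 1)
      have h' : (((k : ℤ) - 1 : ℤ) + 1 : ℝ) * θ = Real.pi := by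
        rw [hk] at hmθ; push_cast at hmθ ⊢; linarith
      rw [h', Real.sin_pi] at this
      exact (mul_eq_zero.1 this).resolve_right hsin
    rw [e1, e2, hz]
    simp
  · have e1 : ((m : ℤ) - 2) / 2 = (k : ℤ) - 1 := by omega
    have e2 : ((m : ℤ) - 1) / 2 = (k : ℤ) := by omega
    have e3 : ((m : ℤ) - 3) / 2 = (k : ℤ) - 1 := by omega
    have e4 : (m : ℤ) / 2 = (k : ℤ) := by omega
    have hz : (S ℝ (k : ℤ)).eval (2 * Real.cos θ) + (S ℝ ((k : ℤ) - 1)).eval (2 * Real.cos θ) = 0 := by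
      have a1 := S_two_mul_real_cos θ (k : ℤ)
      have a2 := S_two_mul_real_cos θ ((k : ℤ) - 1)
      have h' : (((k : ℤ) : ℝ) + 1) * θ = 2 * Real.pi - (((k : ℤ) - 1 : ℤ) + 1 : ℝ) * θ := by
        rw [hk] at hmθ; push_cast at hmθ ⊢; linarith
      rw [h', Real.sin_two_pi_sub] at a1
      have : ((S ℝ (k : ℤ)).eval (2 * Real.cos θ) + (S ℝ ((k : ℤ) - 1)).eval (2 * Real.cos θ))
        * Real.sin θ = 0 := by rw [add_mul]; linarith
      exact (mul_eq_zero.1 this).resolve_right hsin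
    rw [e1, e2, e3, e4, hz]
    simp

/-- The geometric representation: involutions satisfying the Coxeter relations, pairwise distinct
and nontrivial. -/
lemma aux_geom {B : Type*} (M : CoxeterMatrix B) :
    ∃ σ : B → ((B →₀ ℝ) ≃ₗ[ℝ] (B →₀ ℝ)), M.IsLiftable σ ∧ Function.Injective σ ∧
      ∀ i, σ i ≠ 1 := by
  let f : B → Module.Dual ℝ (B →₀ ℝ) := fun a =>
    Finsupp.linearCombination ℝ (fun b => -2 * Real.cos (Real.pi / M a b))
  let e : B → (B →₀ ℝ) := fun a => Finsupp.single a 1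
  have hfe : ∀ a b, f a (e b) = -2 * Real.cos (Real.pi / M a b) := by
    intro a b; simp [f, e]
  have h2 : ∀ a, f a (e a) = 2 := by
    intro a; rw [hfe]; simp
  refine ⟨fun a => Module.reflection (h2 a), ?_, ?_, ?_⟩
  · intro a b
    by_cases hab : a = b
    · subst hab
      rw [M.diagonal, pow_one]
      ext1 z
      exact Module.involutive_reflection (h2 a) z
    · exact aux_refl_pow (h2 a) (h2 b) _ (M.off_diagonal a b hab) (hfe a b)
        (by rw [hfe, M.symmetric])
  · intro a b hab
    by_contra hne
    have h1 := congrArg (fun F : (B →₀ ℝ) ≃ₗ[ℝ] (B →₀ ℝ) => F (e a) a) hab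
    simp only [Module.reflection_apply] at h1
    rw [h2] at h1
    simp [e, Ne.symm hne] at h1
  · intro a ha
    have h1 := congrArg (fun F : (B →₀ ℝ) ≃ₗ[ℝ] (B →₀ ℝ) => F (e a) a) ha
    simp only [Module.reflection_apply] at h1
    rw [h2] at h1
    simp [e] at h1

lemma aux_conj_comm {G A : Type*} [Group G] [CommGroup A] (F : G →* A) {a b : G}
    (h : IsConj a b) : F a = F b := by
  obtain ⟨c, rfl⟩ := isConj_iff.1 h
  simp

lemma aux_conj_one {G A : Type*} [Group G] [Group A] (F : G →* A) {a b : G}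
    (h : IsConj a b) (ha : F a = 1) : F b = 1 := by
  obtain ⟨c, rfl⟩ := isConj_iff.1 h
  simp [ha]

/-- sign homs for even systems -/
lemma aux_sign {B W : Type*} [Group W] {M : CoxeterMatrix B} (cs : CoxeterSystem M W)
    (h : ∀ i j : B, i ≠ j → Even (M i j)) (i : B) :
    ∃ F : W →* ℤˣ, F (cs.simple i) = -1 ∧ ∀ j, j ≠ i → F (cs.simple j) = 1 := by
  classical
  have hl : M.IsLiftable (fun j => if j = i then (-1 : ℤˣ) else 1) := by
    intro a b
    by_cases hab : a = b
    · subst hab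
      by_cases ha : a = i <;> simp [ha]
    · obtain ⟨k, hk⟩ := h a b hab
      rw [hk, ← two_mul, pow_mul, Int.units_sq, one_pow]
  refine ⟨cs.lift ⟨_, hl⟩, ?_, ?_⟩
  · rw [cs.lift_apply_simple]; simp
  · intro j hj; rw [cs.lift_apply_simple]; simp [hj]

lemma aux_conj_inj {B W : Type*} [Group W] {M : CoxeterMatrix B} (cs : CoxeterSystem M W)
    (h : ∀ i j : B, i ≠ j → Even (M i j)) {i j : B}
    (hc : IsConj (cs.simple i) (cs.simple j)) : i = j := by
  by_contra hne
  obtain ⟨F, h1, h2⟩ := aux_sign cs h i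
  have := aux_conj_comm F hc
  rw [h1, h2 j (Ne.symm hne)] at this
  exact absurd this (by decide)

lemma aux_conj_sr {n : ℕ} {x : ZMod n} {g : DihedralGroup n}
    (h : IsConj (DihedralGroup.sr x) g) : ∃ y, g = DihedralGroup.sr y := by
  obtain ⟨c, rfl⟩ := isConj_iff.1 h
  cases c <;> simp

lemma aux_dvd {B B' W : Type*} [Group W] {M : CoxeterMatrix B} {M' : CoxeterMatrix B'}
    (cs : CoxeterSystem M W) (cs' : CoxeterSystem M' W)
    (h : ∀ i j : B, i ≠ j → Even (M i j)) (φ : B' → B) (hφ : Function.Injective φ)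
    (hc : ∀ j, IsConj (cs.simple (φ j)) (cs'.simple j)) (a b : B') (hab : a ≠ b) :
    M (φ a) (φ b) ∣ M' a b := by
  classical
  have hne : φ a ≠ φ b := fun e => hab (hφ e)
  generalize hn : M (φ a) (φ b) = n
  let f : B → DihedralGroup n := fun j =>
    if j = φ a then DihedralGroup.sr 0 else if j = φ b then DihedralGroup.sr 1 else 1
  have hsq : ∀ j, f j * f j = 1 := by
    intro j; simp only [f]; split_ifs <;> simp
  have fa : f (φ a) = DihedralGroup.sr 0 := by simp [f]
  have fb : f (φ b) = DihedralGroup.sr 1 := by simp [f, hne.symm]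
  have fo : ∀ j, j ≠ φ a → j ≠ φ b → f j = 1 := by intro j h1 h2; simp [f, h1, h2]
  have hl : M.IsLiftable f := by
    intro p q
    by_cases hpq : p = q
    · subst hpq; rw [hsq, one_pow]
    obtain ⟨k, hk⟩ := h p q hpq
    by_cases hp : p ≠ φ a ∧ p ≠ φ b
    · rw [fo p hp.1 hp.2, one_mul, hk, ← two_mul, pow_mul, pow_two, hsq, one_pow]
    by_cases hq : q ≠ φ a ∧ q ≠ φ b
    · rw [fo q hq.1 hq.2, mul_one, hk, ← two_mul, pow_mul, pow_two, hsq, one_pow]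
    have : (p = φ a ∧ q = φ b) ∨ (p = φ b ∧ q = φ a) := by
      by_cases p1 : p = φ a <;> by_cases q1 : q = φ a <;> simp_all
    rcases this with ⟨rfl, rfl⟩ | ⟨rfl, rfl⟩
    · rw [fa, fb, hn]; simp
    · rw [fa, fb, M.symmetric, hn]; simp
  let F : W →* DihedralGroup n := cs.lift ⟨f, hl⟩
  have hF : ∀ j, F (cs.simple j) = f j := fun j => cs.lift_apply_simple hl j
  obtain ⟨x, hx⟩ : ∃ x, F (cs'.simple a) = DihedralGroup.sr x := by
    apply aux_conj_sr (x := 0); rw [← fa, ← hF]; exact MonoidHom.map_isConj F (hc a)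
  obtain ⟨y, hy⟩ : ∃ x, F (cs'.simple b) = DihedralGroup.sr x := by
    apply aux_conj_sr (x := 1); rw [← fb, ← hF]; exact MonoidHom.map_isConj F (hc b)
  have ho : ∀ j, j ≠ a → j ≠ b → F (cs'.simple j) = 1 := by
    intro j h1 h2
    apply aux_conj_one F (hc j)
    rw [hF]; exact fo _ (fun e => h1 (hφ e)) (fun e => h2 (hφ e))
  have key : ∀ w : W, ∃ k : ℤ, F w = DihedralGroup.r ((k : ZMod n) * (y - x)) ∨
      F w = DihedralGroup.sr (x + (k : ZMod n) * (y - x)) := by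
    intro w
    induction w using cs'.simple_induction_left with
    | one => exact ⟨0, Or.inl (by simp)⟩
    | mul_simple_left w j ih =>
      obtain ⟨k, ih⟩ := ih
      rw [map_mul]
      by_cases ja : j = a
      · subst ja
        rw [hx]
        rcases ih with ih | ih
        · exact ⟨k, Or.inr (by rw [ih]; simp)⟩
        · exact ⟨k, Or.inl (by rw [ih]; simp)⟩
      by_cases jb : j = b
      · subst jb
        rw [hy]
        rcases ih with ih | ih
        · exact ⟨k + 1, Or.inr (by
            rw [ih, DihedralGroup.sr_mul_r]; congr 1; push_cast; ring)⟩
        · exact ⟨k - 1, Or.inl (by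
            rw [ih, DihedralGroup.sr_mul_sr]; congr 1; push_cast; ring)⟩
      rw [ho j ja jb, one_mul]
      exact ⟨k, ih⟩
  obtain ⟨k, hk⟩ := key (cs.simple (φ a) * cs.simple (φ b))
  rw [map_mul, hF, hF, fa, fb, DihedralGroup.sr_mul_sr] at hk
  have hk' : (1 : ZMod n) = k * (y - x) := by simpa using hk
  have hp : F ((cs'.simple a * cs'.simple b) ^ M' a b) = 1 := by
    rw [cs'.simple_mul_simple_pow, map_one]
  rw [map_pow, map_mul, hx, hy, DihedralGroup.sr_mul_sr, DihedralGroup.r_pow,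
    DihedralGroup.one_def] at hp
  have hp' : (y - x) * (M' a b : ZMod n) = 0 := by injection hp
  rw [← ZMod.natCast_eq_zero_iff]
  calc (M' a b : ZMod n) = 1 * (M' a b : ZMod n) := by rw [one_mul]
    _ = k * ((y - x) * (M' a b : ZMod n)) := by rw [hk', mul_assoc]
    _ = 0 := by rw [hp', mul_zero]

lemma aux_inj {B B' W : Type*} [Group W] {M : CoxeterMatrix B} {M' : CoxeterMatrix B'}
    (cs : CoxeterSystem M W) (cs' : CoxeterSystem M' W)
    (h : ∀ i j : B, i ≠ j → Even (M i j)) (φ : B' → B)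
    (hc : ∀ j, IsConj (cs.simple (φ j)) (cs'.simple j))
    (ψ : B → B') (hψ : ∀ i, φ (ψ i) = i) : Function.Injective φ := by
  classical
  intro j1 j2 hj
  obtain ⟨σ, hσ, hinj, hne⟩ := aux_geom M'
  obtain ⟨F, hF1, hF2⟩ := aux_sign cs h (φ j1)
  have hσ2 : ∀ j, σ j * σ j = 1 := by
    intro j; have := hσ j j; rwa [M'.diagonal, pow_one] at this
  have hev : ∀ a b, φ a = φ j1 → φ b ≠ φ j1 → Even (M' a b) := by
    intro a b ha hb
    have h1 : F (cs'.simple a) = -1 := by rw [← aux_conj_comm F (hc a), ha, hF1]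
    have h2 : F (cs'.simple b) = 1 := by rw [← aux_conj_comm F (hc b), hF2 _ hb]
    have hp : F ((cs'.simple a * cs'.simple b) ^ M' a b) = 1 := by
      rw [cs'.simple_mul_simple_pow, map_one]
    rw [map_pow, map_mul, h1, h2, mul_one] at hp
    by_contra hodd
    rw [Nat.not_even_iff_odd] at hodd
    rw [hodd.neg_one_pow] at hp
    exact absurd hp (by decide)
  let g : B' → ((B' →₀ ℝ) ≃ₗ[ℝ] (B' →₀ ℝ)) := fun j => if φ j = φ j1 then σ j else 1
  have gi : ∀ j, φ j = φ j1 → g j = σ j := fun j hj => if_pos hj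
  have go : ∀ j, φ j ≠ φ j1 → g j = 1 := fun j hj => if_neg hj
  have hl : M'.IsLiftable g := by
    intro a b
    by_cases ha : φ a = φ j1 <;> by_cases hb : φ b = φ j1
    · rw [gi a ha, gi b hb]; exact hσ a b
    · obtain ⟨k, hk⟩ := hev a b ha hb
      rw [gi a ha, go b hb, mul_one, hk, ← two_mul, pow_mul, pow_two, hσ2, one_pow]
    · obtain ⟨k, hk⟩ := hev b a hb ha
      rw [go a ha, gi b hb, one_mul, M'.symmetric, hk, ← two_mul, pow_mul, pow_two, hσ2, one_pow]
    · rw [go a ha, go b hb, one_mul, one_pow]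
  let G : W →* ((B' →₀ ℝ) ≃ₗ[ℝ] (B' →₀ ℝ)) := cs'.lift ⟨g, hl⟩
  have hG : ∀ j, G (cs'.simple j) = g j := fun j => cs'.lift_apply_simple hl j
  have hk : ∀ k, k ≠ φ j1 → G (cs.simple k) = 1 := by
    intro k hk
    have := hc (ψ k)
    rw [hψ] at this
    apply aux_conj_one G this.symm
    rw [hG, go]; rwa [hψ]
  have key : ∀ w, G w = 1 ∨ G w = G (cs.simple (φ j1)) := by
    intro w
    induction w using cs.simple_induction_left with
    | one => left; simp
    | mul_simple_left w j ih =>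
      rw [map_mul]
      by_cases hj : j = φ j1
      · rw [hj]
        rcases ih with ih | ih
        · right; rw [ih, mul_one]
        · left; rw [ih, ← map_mul]; simp
      · rw [hk j hj, one_mul]; exact ih
  have e1 := (key (cs'.simple j1)).resolve_left (by rw [hG, gi j1 rfl]; exact hne _)
  have e2 := (key (cs'.simple j2)).resolve_left (by rw [hG, gi j2 hj.symm]; exact hne _)
  rw [hG, gi j1 rfl] at e1
  rw [hG, gi j2 hj.symm] at e2
  exact hinj (e1.trans e2.symm)


/-- If `(W, S)` is an even Coxeter system (for all distinct `s, t ∈ S`, `m (s, t)` is even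
or `∞`), then `(W, S)` is reflection rigid. -/
theorem reflectionRigid_of_even {B W : Type*} [Group W] [Finite B]
    {M : CoxeterMatrix B} (cs : CoxeterSystem M W)
    (h : ∀ i j : B, i ≠ j → Even (M i j)) :
    cs.ReflectionRigid := by
  intro B' _ M' cs' hr
  have h1 : ∀ j, ∃ i, IsConj (cs.simple i) (cs'.simple j) := by
    intro j
    obtain ⟨w, i, hw⟩ := (hr _).2 (cs'.isReflection_simple j)
    exact ⟨i, isConj_iff.2 ⟨w, hw.symm⟩⟩
  have h2 : ∀ i, ∃ j, IsConj (cs'.simple j) (cs.simple i) := by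
    intro i
    obtain ⟨w, j, hw⟩ := (hr _).1 (cs.isReflection_simple i)
    exact ⟨j, isConj_iff.2 ⟨w, hw.symm⟩⟩
  choose φ hφ using h1
  choose ψ hψ using h2
  have hφψ : ∀ i, φ (ψ i) = i := fun i =>
    aux_conj_inj cs h ((hφ (ψ i)).trans (hψ i))
  have hinj : Function.Injective φ := aux_inj cs cs' h φ hφ ψ hφψ
  have hψφ : ∀ j, ψ (φ j) = j := fun j => hinj (hφψ _)
  have hd := aux_dvd cs cs' h φ hinj hφ
  have h' : ∀ i j : B', i ≠ j → Even (M' i j) := fun i j hij =>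
    (h _ _ (fun e => hij (hinj e))).trans_dvd (hd i j hij)
  have hinj' : Function.Injective ψ := Function.LeftInverse.injective hφψ
  have hd' := aux_dvd cs' cs h' ψ hinj' hψ
  refine ⟨⟨ψ, φ, hφψ, hψφ⟩, fun i j => ?_⟩
  show M i j = M' (ψ i) (ψ j)
  by_cases hij : i = j
  · subst hij; simp
  · apply Nat.dvd_antisymm
    · have := hd (ψ i) (ψ j) (fun e => hij (hinj' e))
      rwa [hφψ, hφψ] at this
    · exact hd' i j hij
end

section
/- If (W,S) is a Coxeter system such that the group W is finite, then (W,S) is reflection rigid. -/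
/-!
In Mathlib's `CoxeterMatrix`, the entry `M i j : ℕ` is the order of `s i * s j`,
with `0` encoding the order `∞` (so `Even (M i j)` means that the order is even or `∞`).
-/

universe u v w

set_option linter.unusedSectionVars false
set_option linter.unusedSimpArgs false
namespace CoxRig
open Real

variable {B : Type*} [Fintype B] [DecidableEq B]

noncomputable def gr (M : CoxeterMatrix B) : Matrix B B ℝ :=
  Matrix.of fun i j => -Real.cos (π / (M i j : ℝ))

noncomputable def fm (M : CoxeterMatrix B) : LinearMap.BilinForm ℝ (B → ℝ) :=
  Matrix.toBilin' (gr M)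

abbrev e (i : B) : B → ℝ := Pi.single i 1

lemma gr_self (M : CoxeterMatrix B) (i : B) : gr M i i = 1 := by simp [gr]

lemma gr_symm (M : CoxeterMatrix B) (i j : B) : gr M i j = gr M j i := by
  simp [gr, M.symmetric i j]

lemma fm_apply (M : CoxeterMatrix B) (x y : B → ℝ) :
    fm M x y = ∑ i, ∑ j, x i * gr M i j * y j := by
  simp [fm, Matrix.toBilin'_apply]

lemma fm_e (M : CoxeterMatrix B) (i j : B) : fm M (e i) (e j) = gr M i j := by
  simp [fm, Matrix.toBilin'_single]

lemma fm_e_left (M : CoxeterMatrix B) (i : B) (y : B → ℝ) :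
    fm M (e i) y = ∑ j, gr M i j * y j := by
  rw [fm_apply, Finset.sum_eq_single i]
  · simp
  · intro b _ hb; simp [hb]
  · simp

lemma fm_symm (M : CoxeterMatrix B) (x y : B → ℝ) : fm M x y = fm M y x := by
  rw [fm_apply, fm_apply, Finset.sum_comm]
  refine Finset.sum_congr rfl fun i _ => Finset.sum_congr rfl fun j _ => ?_
  rw [gr_symm M j i]; ring

lemma M_ge_two (M : CoxeterMatrix B) {i j : B} (h : i ≠ j) (h0 : M i j ≠ 0) : 2 ≤ M i j := by
  have := M.off_diagonal i j h
  omega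

lemma gr_nonpos (M : CoxeterMatrix B) {i j : B} (h : i ≠ j) : gr M i j ≤ 0 := by
  by_cases h0 : M i j = 0
  · simp [gr, h0]
  · have := M_ge_two M h h0
    have h2 : (2 : ℝ) ≤ M i j := by exact_mod_cast this
    simp only [gr, Matrix.of_apply, neg_nonpos]
    apply Real.cos_nonneg_of_neg_pi_div_two_le_of_le
    · have : 0 ≤ π / M i j := by positivity
      linarith [pi_pos]
    · apply div_le_div_of_nonneg_left pi_pos.le (by norm_num) h2

/-- monotonicity: label at least `k` -/
lemma gr_le (M : CoxeterMatrix B) {i j : B} {k : ℕ} (hk : 2 ≤ k)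
    (h : k ≤ M i j ∨ M i j = 0) : gr M i j ≤ -Real.cos (π / k) := by
  simp only [gr, Matrix.of_apply, neg_le_neg_iff]
  have hk' : (2 : ℝ) ≤ k := by exact_mod_cast hk
  rcases h with h | h
  · have h' : (k : ℝ) ≤ M i j := by exact_mod_cast h
    apply Real.cos_le_cos_of_nonneg_of_le_pi
    · positivity
    · apply div_le_self pi_pos.le; linarith
    · apply div_le_div_of_nonneg_left pi_pos.le (by linarith) h'
  · simp [h, Real.cos_le_one]

lemma gr_eq_zero (M : CoxeterMatrix B) {i j : B} (h : M i j = 2) : gr M i j = 0 := by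
  simp [gr, h]

lemma gr_le_half (M : CoxeterMatrix B) {i j : B} (h : i ≠ j) (h2 : M i j ≠ 2) :
    gr M i j ≤ -(1/2) := by
  have := M.off_diagonal i j h
  have := gr_le M (i := i) (j := j) (k := 3) (by norm_num) (by omega)
  simpa using this

noncomputable def rf (M : CoxeterMatrix B) (i : B) : Module.End ℝ (B → ℝ) :=
  LinearMap.id - ((2 : ℝ) • fm M (e i)).smulRight (e i)

lemma rf_apply (M : CoxeterMatrix B) (i : B) (x : B → ℝ) :
    rf M i x = x - (2 * fm M (e i) x) • e i := by
  simp [rf]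

lemma rf_rf (M : CoxeterMatrix B) (i : B) (x : B → ℝ) : rf M i (rf M i x) = x := by
  simp only [rf_apply, map_sub, map_smul, fm_e, gr_self, smul_eq_mul]
  module

lemma fm_rf (M : CoxeterMatrix B) (i : B) (x y : B → ℝ) :
    fm M (rf M i x) (rf M i y) = fm M x y := by
  simp only [rf_apply, map_sub, map_smul, fm_e, gr_self, smul_eq_mul, LinearMap.sub_apply,
    LinearMap.smul_apply, fm_symm M x (e i)]
  ring

/-- the rotation formula. -/
lemma rot_pow (M : CoxeterMatrix B) (i j : B) (hs : sin (π / M i j) ≠ 0) (k : ℕ) :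
    ((rf M i * rf M j) ^ k) (e i) =
      (sin ((2 * k + 1) * (π / M i j)) / sin (π / M i j)) • e i +
      (sin ((2 * k) * (π / M i j)) / sin (π / M i j)) • e j := by
  induction k with
  | zero => simp [hs]
  | succ k ih =>
    rw [pow_succ', Module.End.mul_apply, ih]
    simp only [Module.End.mul_apply, rf_apply, map_add, map_sub, map_smul, fm_e, gr_self,
      smul_eq_mul, gr_symm M j i]
    simp only [gr, Matrix.of_apply]
    push_cast
    set θ := π / (M i j : ℝ)
    have h1 : sin ((2 * k + 2) * θ) = 2 * cos θ * sin ((2 * k + 1) * θ) - sin (2 * k * θ) := by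
      have a : (2 * (k:ℝ) + 2) * θ = (2 * k + 1) * θ + θ := by ring
      have b : (2 * (k:ℝ)) * θ = (2 * k + 1) * θ - θ := by ring
      rw [a, b, sin_add, sin_sub]; ring
    have h2 : sin ((2 * k + 3) * θ) = 2 * cos θ * sin ((2 * k + 2) * θ) - sin ((2 * k + 1) * θ) := by
      have a : (2 * (k:ℝ) + 3) * θ = (2 * k + 2) * θ + θ := by ring
      have b : (2 * (k:ℝ) + 1) * θ = (2 * k + 2) * θ - θ := by ring
      rw [a, b, sin_add, sin_sub]; ring
    rw [show (2 * ((k:ℝ) + 1) + 1) * θ = (2 * k + 3) * θ by ring,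
      show (2 * ((k:ℝ) + 1)) * θ = (2 * k + 2) * θ by ring, h2, h1]
    match_scalars <;> field_simp <;> ring

lemma sin_ne (M : CoxeterMatrix B) {i j : B} (h : i ≠ j) (h0 : M i j ≠ 0) :
    0 < sin (π / M i j) := by
  have := M_ge_two M h h0
  have h2 : (2 : ℝ) ≤ M i j := by exact_mod_cast this
  apply sin_pos_of_pos_of_lt_pi
  · positivity
  · apply div_lt_self pi_pos; linarith

lemma rot_pow_M (M : CoxeterMatrix B) {i j : B} (h : i ≠ j) (h0 : M i j ≠ 0) :
    ((rf M i * rf M j) ^ (M i j)) (e i) = e i := by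
  have hs := (sin_ne M h h0).ne'
  rw [rot_pow M i j hs]
  have hm : (M i j : ℝ) ≠ 0 := by exact_mod_cast h0
  have h1 : (2 * (M i j : ℝ) + 1) * (π / M i j) = π / M i j + 2 * π := by field_simp; ring
  have h2 : (2 * (M i j : ℝ)) * (π / M i j) = 2 * π := by field_simp
  rw [h1, h2, sin_add_two_pi, sin_two_pi]
  simp [hs]

lemma rf_mul_self (M : CoxeterMatrix B) (i : B) : rf M i * rf M i = 1 := by
  refine LinearMap.ext fun x => ?_
  rw [Module.End.mul_apply, rf_rf, Module.End.one_apply]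

lemma liftable (M : CoxeterMatrix B) : M.IsLiftable (rf M) := by
  intro i j
  by_cases h : i = j
  · subst h; simp [rf_mul_self]
  by_cases h0 : M i j = 0
  · simp [h0]
  have hs := (sin_ne M h h0)
  have hi := rot_pow_M M h h0
  have hj : ((rf M i * rf M j) ^ (M i j)) (e j) = e j := by
    have h' := rot_pow_M M (Ne.symm h) (by rwa [M.symmetric])
    rw [M.symmetric j i] at h'
    have hinv : (rf M i * rf M j) ^ (M i j) * (rf M j * rf M i) ^ (M i j) = 1 := by
      have hc : Commute (rf M i * rf M j) (rf M j * rf M i) := by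
        show _ = _
        have a : ∀ x y : B, rf M x * rf M y * (rf M y * rf M x) = 1 := by
          intro x y
          rw [mul_assoc, ← mul_assoc (rf M y) (rf M y), rf_mul_self, one_mul, rf_mul_self]
        rw [a, a]
      rw [← hc.mul_pow, mul_assoc, ← mul_assoc (rf M j) (rf M j)]
      simp [rf_mul_self]
    have := congrArg (fun g => g (e j)) hinv
    simp only [Module.End.mul_apply, Module.End.one_apply, h'] at this
    exact this
  refine LinearMap.ext fun x => ?_
  set c := cos (π / M i j) with hc
  have hg : gr M i j = -c := rfl
  have hd : 1 - c ^ 2 ≠ 0 := by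
    have := sin_sq_add_cos_sq (π / M i j)
    rw [← hc] at this
    have h3 : 1 - c ^ 2 = sin (π / M i j) ^ 2 := by linarith
    rw [h3]; positivity
  set u := fm M (e i) x with hu
  set v := fm M (e j) x with hv
  set p := (u + c * v) / (1 - c ^ 2) with hp
  set q := (v + c * u) / (1 - c ^ 2) with hq
  set z := x - p • e i - q • e j with hz
  have hz1 : fm M (e i) z = 0 := by
    simp only [hz, map_sub, map_smul, fm_e, gr_self, hg, smul_eq_mul, ← hu, hp, hq]
    field_simp; ring
  have hz2 : fm M (e j) z = 0 := by
    simp only [hz, map_sub, map_smul, fm_e, gr_self, gr_symm M j i, hg, smul_eq_mul, ← hv, hp, hq]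
    field_simp; ring
  have hT : ∀ k : ℕ, ((rf M i * rf M j) ^ k) z = z := by
    intro k
    induction k with
    | zero => simp
    | succ k ih =>
      rw [pow_succ', Module.End.mul_apply, ih]
      simp [rf_apply, hz1, hz2]
  have hx : x = z + p • e i + q • e j := by rw [hz]; abel
  rw [hx]
  simp only [map_add, map_smul, hT, hi, hj, Module.End.one_apply]

variable {W : Type*} [Group W] {M : CoxeterMatrix B} (cs : CoxeterSystem M W)

noncomputable def rep : W →* Module.End ℝ (B → ℝ) := cs.lift ⟨rf M, liftable M⟩

lemma rep_simple (i : B) : rep cs (cs.simple i) = rf M i := cs.lift_apply_simple (liftable M) i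

lemma rep_simple_apply (i : B) (x : B → ℝ) :
    rep cs (cs.simple i) x = x - (2 * fm M (e i) x) • e i := by
  rw [rep_simple, rf_apply]

lemma rep_mul (v w : W) (x : B → ℝ) : rep cs (v * w) x = rep cs v (rep cs w x) := by
  rw [map_mul, Module.End.mul_apply]

lemma rep_inv_self (w : W) (x : B → ℝ) : rep cs w⁻¹ (rep cs w x) = x := by
  rw [← rep_mul]; simp

lemma rep_self_inv (w : W) (x : B → ℝ) : rep cs w (rep cs w⁻¹ x) = x := by
  rw [← rep_mul]; simp

lemma fm_rep (w : W) (x y : B → ℝ) : fm M (rep cs w x) (rep cs w y) = fm M x y := by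
  induction w using cs.simple_induction_left with
  | one => simp
  | mul_simple_left w i ih => rw [rep_mul, rep_mul, rep_simple, fm_rf, ih]

lemma simple_ne {i j : B} (h : i ≠ j) : cs.simple i ≠ cs.simple j := by
  intro he
  have h1 := congrArg (fun w => rep cs w (e i)) he
  simp only [rep_simple_apply, fm_e, gr_self] at h1
  have h2 := congrFun h1 i
  simp [h] at h2

lemma rep_refl (w : W) (i : B) (x : B → ℝ) :
    rep cs (w * cs.simple i * w⁻¹) x =
      x - (2 * fm M (rep cs w (e i)) x) • rep cs w (e i) := by
  rw [rep_mul, rep_mul, rep_simple_apply, map_sub, map_smul, rep_self_inv]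
  congr 3
  rw [← fm_rep cs w (e i), rep_self_inv]

lemma fm_root (w : W) (i : B) : fm M (rep cs w (e i)) (rep cs w (e i)) = 1 := by
  rw [fm_rep, fm_e, gr_self]

lemma order_simple {i j : B} (h0 : M i j ≠ 0) :
    orderOf (cs.simple i * cs.simple j) = M i j := by
  by_cases h : i = j
  · subst h; simp
  have hd : orderOf (cs.simple i * cs.simple j) ∣ M i j :=
    orderOf_dvd_of_pow_eq_one (cs.simple_mul_simple_pow i j)
  have hs := sin_ne M h h0
  have h1 := congrArg (fun w => rep cs w (e i)) (pow_orderOf_eq_one (cs.simple i * cs.simple j))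
  set d := orderOf (cs.simple i * cs.simple j)
  simp only [map_pow, map_mul, rep_simple, map_one, Module.End.one_apply] at h1
  rw [rot_pow M i j hs.ne'] at h1
  have hi := congrFun h1 i
  have hj := congrFun h1 j
  simp [h, Ne.symm h, hs.ne'] at hi hj
  rw [div_eq_one_iff_eq hs.ne'] at hi
  obtain ⟨q, hq⟩ := hd
  have hd0 : d ≠ 0 := by rintro h; apply h0; simp [hq, h]
  have hq0 : q ≠ 0 := by rintro h; apply h0; simp [hq, h]
  have hdr : (d : ℝ) ≠ 0 := by exact_mod_cast hd0
  have hqr : (q : ℝ) ≠ 0 := by exact_mod_cast hq0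
  have e1 : 2 * (d : ℝ) * (π / (M i j : ℝ)) = 2 * π / q := by
    rw [hq]; push_cast; field_simp
  rw [e1] at hj
  rw [add_mul, e1, one_mul] at hi
  rcases Nat.lt_or_ge q 3 with h3 | h3
  · interval_cases q
    · exact absurd rfl hq0
    · rw [hq, mul_one]
    · exfalso
      have : 2 * π / ((2 : ℕ) : ℝ) = π := by push_cast; field_simp
      rw [this, add_comm, sin_add_pi] at hi
      linarith
  · exfalso
    have h3' : (3 : ℝ) ≤ q := by exact_mod_cast h3
    have : 0 < sin (2 * π / q) := by
      apply sin_pos_of_pos_of_lt_pi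
      · positivity
      · rw [div_lt_iff₀ (by positivity)]; nlinarith [pi_pos]
    linarith

end CoxRig

namespace CoxRig
open Real

variable {B : Type*} [Fintype B] [DecidableEq B]
variable {W : Type*} [Group W] {M : CoxeterMatrix B} (cs : CoxeterSystem M W)

lemma eq_sum_e (x : B → ℝ) : x = ∑ i, x i • e i := by
  ext j
  simp [Finset.sum_apply, Pi.single_apply]

section avg
variable [Fintype W]

noncomputable def av (x y : B → ℝ) : ℝ := ∑ w : W, ∑ b, rep cs w x b * rep cs w y b

lemma av_rep (v : W) (x y : B → ℝ) : av cs (rep cs v x) (rep cs v y) = av cs x y := by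
  unfold av
  rw [← Equiv.sum_comp (Equiv.mulRight v) (fun w => ∑ b, rep cs w x b * rep cs w y b)]
  simp [rep_mul]

lemma av_symm (x y : B → ℝ) : av cs x y = av cs y x := by
  unfold av; simp [mul_comm]

lemma av_add (x y z : B → ℝ) : av cs (x + y) z = av cs x z + av cs y z := by
  unfold av; simp [add_mul, Finset.sum_add_distrib]

lemma av_smul (c : ℝ) (x z : B → ℝ) : av cs (c • x) z = c * av cs x z := by
  unfold av; simp [Finset.mul_sum, mul_assoc]

lemma av_sum {ι : Type*} (s : Finset ι) (f : ι → B → ℝ) (z : B → ℝ) :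
    av cs (∑ i ∈ s, f i) z = ∑ i ∈ s, av cs (f i) z := by
  classical
  induction s using Finset.induction_on with
  | empty => simp [av]
  | insert a s ha ih => rw [Finset.sum_insert ha, Finset.sum_insert ha, av_add, ih]

lemma av_pos (x : B → ℝ) (hx : x ≠ 0) : 0 < av cs x x := by
  unfold av
  obtain ⟨b, hb⟩ : ∃ b, x b ≠ 0 := by
    by_contra h; push Not at h; exact hx (funext h)
  apply Finset.sum_pos'
  · intro w _; exact Finset.sum_nonneg fun b _ => mul_self_nonneg _
  · refine ⟨1, Finset.mem_univ _, ?_⟩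
    apply Finset.sum_pos'
    · intro b _; exact mul_self_nonneg _
    · exact ⟨b, Finset.mem_univ _, by simpa using mul_self_pos.mpr hb⟩

lemma av_simple (i : B) (x : B → ℝ) : av cs x (e i) = fm M (e i) x * av cs (e i) (e i) := by
  have h := av_rep cs (cs.simple i) x (e i)
  have h2 : rep cs (cs.simple i) (e i) = (-1 : ℝ) • e i := by
    rw [rep_simple_apply, fm_e, gr_self]; module
  rw [h2, av_symm, av_smul, av_symm, rep_simple_apply, sub_eq_add_neg, ← neg_smul, av_add, av_smul] at h
  linarith

lemma fm_pos_aux (cs : CoxeterSystem M W) (x : B → ℝ) (hx : x ≠ 0) : 0 < fm M x x := by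
  set c : B → ℝ := fun i => av cs (e i) (e i) with hc
  have hcpos : ∀ i, 0 < c i := fun i => av_pos cs _ (by
    intro h; have := congrFun h i; simp at this)
  have hcc : ∀ i j, gr M i j ≠ 0 → c i = c j := by
    intro i j hg
    have h1 := av_simple cs i (e j)
    have h2 := av_simple cs j (e i)
    rw [av_symm, h2, fm_e, fm_e, gr_symm M j i] at h1
    exact (mul_left_cancel₀ hg h1).symm
  set y : B → ℝ := fun i => x i / √(c i) with hy
  have hsq : ∀ i, √(c i) ≠ 0 := fun i => (Real.sqrt_pos.mpr (hcpos i)).ne'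
  have hy0 : y ≠ 0 := by
    intro h
    apply hx
    ext i
    have := congrFun h i
    simp only [hy, Pi.zero_apply, div_eq_zero_iff, hsq i, or_false] at this
    simpa using this
  have h1 := av_pos cs y hy0
  have h2 : av cs y y = fm M x x := by
    conv_lhs => rw [eq_sum_e y]
    rw [av_sum, fm_apply]
    refine Finset.sum_congr rfl fun i _ => ?_
    rw [av_smul, av_symm, ← eq_sum_e, av_simple, fm_e_left, Finset.sum_mul, Finset.mul_sum]
    refine Finset.sum_congr rfl fun j _ => ?_
    by_cases hg : gr M i j = 0
    · simp [hg]
    · have h3 := hcc i j hg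
      change x i / √(c i) * (gr M i j * (x j / √(c j)) * c i) = _
      rw [← h3]
      have := hsq i
      have h4 : c i = √(c i) * √(c i) := (Real.mul_self_sqrt (hcpos i).le).symm
      field_simp
      nth_rw 1 [h4]; ring
  linarith

end avg

variable [Finite W]

lemma fm_pos {W : Type*} [Group W] [Finite W] (cs : CoxeterSystem M W)
    (x : B → ℝ) (hx : x ≠ 0) : 0 < fm M x x := by
  have := Fintype.ofFinite W
  exact fm_pos_aux cs x hx

lemma M_ne_zero {W : Type*} [Group W] [Finite W] (cs : CoxeterSystem M W) (i j : B) :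
    M i j ≠ 0 := by
  intro h0
  have hij : i ≠ j := by rintro rfl; simp at h0
  have h := fm_pos cs (e i + e j) (by
    intro h; have := congrFun h i; simp [hij] at this)
  simp only [map_add, LinearMap.add_apply, fm_e, gr_self, gr_symm M j i] at h
  have : gr M i j = -1 := by simp [gr, h0]
  rw [this] at h; norm_num at h

lemma alt_rep {i j : B} (hs : sin (π / M i j) ≠ 0) (k : ℕ) :
    rep cs (cs.wordProd (CoxeterSystem.alternatingWord i j k)) (e i) =
      if Even k then
        (sin ((k + 1) * (π / M i j)) / sin (π / M i j)) • e i +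
          (sin (k * (π / M i j)) / sin (π / M i j)) • e j
      else
        (sin (k * (π / M i j)) / sin (π / M i j)) • e i +
          (sin ((k + 1) * (π / M i j)) / sin (π / M i j)) • e j := by
  induction k with
  | zero => simp [hs, CoxeterSystem.alternatingWord]
  | succ k ih =>
    rw [CoxeterSystem.alternatingWord_succ', cs.wordProd_cons, rep_mul, ih]
    have h1 : sin (((k + 1 : ℕ) + 1) * (π / M i j)) =
        2 * cos (π / M i j) * sin ((k + 1) * (π / M i j)) - sin (k * (π / M i j)) := by
      have a : (((k + 1 : ℕ) : ℝ) + 1) * (π / M i j) = (k + 1) * (π / M i j) + (π / M i j) := by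
        push_cast; ring
      have b : (k : ℝ) * (π / M i j) = (k + 1) * (π / M i j) - (π / M i j) := by ring
      rw [a, b, sin_add, sin_sub]; ring
    have hg : gr M i j = - cos (π / M i j) := rfl
    by_cases hk : Even k
    · have hk' : ¬ Even (k + 1) := by simpa [Nat.even_add_one] using hk
      simp only [hk, hk', if_true, if_false, rep_simple_apply, map_add, map_smul, fm_e, gr_self,
        gr_symm M j i, hg, smul_eq_mul, h1]
      push_cast
      match_scalars <;> field_simp <;> ring
    · have hk' : Even (k + 1) := by simpa [Nat.even_add_one] using hk
      simp only [hk, hk', if_true, if_false, rep_simple_apply, map_add, map_smul, fm_e, gr_self,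
        gr_symm M j i, hg, smul_eq_mul, h1]
      push_cast
      match_scalars <;> field_simp <;> ring

lemma alt_pos {i j : B} (hij : i ≠ j) (h0 : M i j ≠ 0) (k : ℕ) (hk : k < M i j) :
    ∃ a b : ℝ, 0 ≤ a ∧ 0 ≤ b ∧
      rep cs (cs.wordProd (CoxeterSystem.alternatingWord i j k)) (e i) = a • e i + b • e j := by
  have hs := sin_ne M hij h0
  have hm : (0 : ℝ) < M i j := by exact_mod_cast Nat.pos_of_ne_zero h0
  have key : ∀ l : ℕ, l ≤ M i j → 0 ≤ sin (l * (π / M i j)) / sin (π / M i j) := by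
    intro l hl
    have hl' : (l : ℝ) ≤ M i j := by exact_mod_cast hl
    apply div_nonneg _ hs.le
    apply sin_nonneg_of_nonneg_of_le_pi
    · positivity
    · rw [mul_div_assoc', div_le_iff₀ hm, mul_comm]
      exact mul_le_mul_of_nonneg_left hl' pi_pos.le
  have k1 := key k hk.le
  have k2 := key (k + 1) hk
  push_cast at k2
  rw [alt_rep cs hs.ne']
  split_ifs
  · exact ⟨_, _, k2, k1, rfl⟩
  · exact ⟨_, _, k1, k2, rfl⟩

theorem root_pos (n : ℕ) : ∀ w : W, cs.length w = n → ∀ i, ¬ cs.IsRightDescent w i →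
    0 ≤ rep cs w (e i) := by
  induction n using Nat.strong_induction_on with
  | _ n IH =>
  intro w hw i hi
  by_cases h1 : w = 1
  · subst h1
    simp only [map_one, Module.End.one_apply]
    intro b
    by_cases hb : b = i
    · subst hb; simp
    · simp [hb]
  obtain ⟨j, hj⟩ := cs.exists_rightDescent_of_ne_one h1
  have hij : i ≠ j := by rintro rfl; exact hi hj
  have h0 := M_ne_zero cs i j
  let A : ℕ → Prop := fun k => ∃ v, w = v * cs.wordProd (CoxeterSystem.alternatingWord i j k) ∧
    cs.length w = cs.length v + k
  classical
  have hA1 : A 1 := by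
    refine ⟨w * cs.simple j, ?_, ?_⟩
    · simp [CoxeterSystem.alternatingWord]
    · rw [cs.isRightDescent_iff] at hj; exact hj.symm
  have hAle : ∀ k, A k → k ≤ cs.length w := by
    rintro k ⟨v, _, h⟩; omega
  set k := Nat.findGreatest A (cs.length w) with hkdef
  have hAk : A k := Nat.findGreatest_spec (hAle 1 hA1) hA1
  have hk1 : 1 ≤ k := Nat.le_findGreatest (hAle 1 hA1) hA1
  have hAk1 : ¬ A (k + 1) := by
    intro h
    have := Nat.le_findGreatest (hAle _ h) h
    omega
  clear_value k
  clear hkdef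
  obtain ⟨v, hv, hlen⟩ := hAk
  have hx : ¬ cs.IsRightDescent v (if Even k then j else i) := by
    intro hd
    apply hAk1
    refine ⟨v * cs.simple (if Even k then j else i), ?_, ?_⟩
    · rw [CoxeterSystem.alternatingWord_succ', cs.wordProd_cons, mul_assoc,
        cs.simple_mul_simple_cancel_left]
      exact hv
    · rw [cs.isRightDescent_iff] at hd; omega
  have hy : ¬ cs.IsRightDescent v (if Even k then i else j) := by
    intro hd
    rw [cs.isRightDescent_iff] at hd
    obtain ⟨l, rfl⟩ : ∃ l, k = l + 1 := ⟨k - 1, by omega⟩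
    have hl : (if Even (l + 1) then i else j) = (if Even l then j else i) := by
      by_cases h : Even l
      · simp [h, Nat.even_add_one]
      · simp [h, Nat.even_add_one]
    rw [CoxeterSystem.alternatingWord_succ', cs.wordProd_cons, ← hl, ← mul_assoc] at hv
    have h2 := cs.length_mul_le (v * cs.simple (if Even (l + 1) then i else j))
      (cs.wordProd (CoxeterSystem.alternatingWord i j l))
    rw [← hv] at h2
    have h3 := cs.length_wordProd_le (CoxeterSystem.alternatingWord i j l)
    rw [CoxeterSystem.length_alternatingWord] at h3
    omega
  have hvi : 0 ≤ rep cs v (e i) := by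
    apply IH (cs.length v) (by omega) v rfl
    by_cases h : Even k
    · simpa [h] using hy
    · simpa [h] using hx
  have hvj : 0 ≤ rep cs v (e j) := by
    apply IH (cs.length v) (by omega) v rfl
    by_cases h : Even k
    · simpa [h] using hx
    · simpa [h] using hy
  have hkM : k < M i j := by
    by_contra hge
    push Not at hge
    have hvw : w * cs.simple i = v * cs.wordProd (CoxeterSystem.alternatingWord i j k) *
      cs.simple i := by rw [← hv]
    have hgen : ∀ l, M i j ≤ l →
        cs.length (cs.wordProd (CoxeterSystem.alternatingWord i j l) * cs.simple i) < l := by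
      intro l hl
      induction l, hl using Nat.le_induction with
      | base =>
        rw [cs.wordProd_braidWord_eq, M.symmetric i j]
        have hji : M j i ≠ 0 := M_ne_zero cs j i
        obtain ⟨q, hq⟩ : ∃ q, M j i = q + 1 := ⟨M j i - 1, by omega⟩
        rw [CoxeterSystem.braidWord, hq, CoxeterSystem.alternatingWord_succ, cs.wordProd_concat]
        rw [cs.simple_mul_simple_cancel_right]
        have h3 := cs.length_wordProd_le (CoxeterSystem.alternatingWord i j q)
        rw [CoxeterSystem.length_alternatingWord] at h3
        omega
      | succ l hl ih =>
        rw [CoxeterSystem.alternatingWord_succ', cs.wordProd_cons, mul_assoc]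
        have := cs.length_mul_le (cs.simple (if Even l then j else i))
          (cs.wordProd (CoxeterSystem.alternatingWord i j l) * cs.simple i)
        rw [cs.length_simple] at this
        omega
    have h4 := hgen k hge
    rw [mul_assoc] at hvw
    have h5 := cs.length_mul_le v
      (cs.wordProd (CoxeterSystem.alternatingWord i j k) * cs.simple i)
    rw [← hvw] at h5
    rw [cs.not_isRightDescent_iff] at hi
    omega
  obtain ⟨a, b, ha, hb, hab⟩ := alt_pos cs hij h0 k hkM
  rw [hv, rep_mul, hab, map_add, map_smul, map_smul]
  exact add_nonneg (smul_nonneg ha hvi) (smul_nonneg hb hvj)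

lemma root_pos_or_neg (w : W) (i : B) : 0 ≤ rep cs w (e i) ∨ rep cs w (e i) ≤ 0 := by
  by_cases h : cs.IsRightDescent w i
  · right
    rw [cs.isRightDescent_iff_not_isRightDescent_mul] at h
    have := root_pos cs _ _ rfl i h
    rw [rep_mul, rep_simple_apply, fm_e, gr_self] at this
    have h2 : e i - (2 * (1:ℝ)) • e i = - e i := by module
    rw [h2, map_neg] at this
    exact neg_nonneg.mp this
  · left; exact root_pos cs _ _ rfl i h

lemma rep_inj {v w : W} (h : rep cs v = rep cs w) : v = w := by
  by_contra hne
  have h1 : v⁻¹ * w ≠ 1 := by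
    intro h; apply hne; exact (inv_mul_eq_one.mp h)
  obtain ⟨j, hj⟩ := cs.exists_rightDescent_of_ne_one h1
  rw [cs.isRightDescent_iff_not_isRightDescent_mul] at hj
  have := root_pos cs _ _ rfl j hj
  rw [rep_mul, rep_mul, ← h, rep_simple_apply, rep_inv_self, fm_e, gr_self] at this
  have := this j
  simp at this

/-- `T` is a union of components -/
def Cl (M : CoxeterMatrix B) (T : Set B) : Prop := ∀ i ∈ T, ∀ k ∉ T, M k i = 2

lemma supp {T : Set B} (hT : Cl M T) (w : W) {i : B} (hi : i ∈ T) :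
    ∀ k ∉ T, rep cs w (e i) k = 0 := by
  induction w using cs.simple_induction_left with
  | one =>
    intro k hk
    have : k ≠ i := by rintro rfl; exact hk hi
    simp [this]
  | mul_simple_left w l ih =>
    intro k hk
    rw [rep_mul, rep_simple_apply]
    by_cases hkl : k = l
    · subst hkl
      have : fm M (e k) (rep cs w (e i)) = 0 := by
        rw [fm_e_left]
        apply Finset.sum_eq_zero
        intro b _
        by_cases hb : b ∈ T
        · rw [gr_eq_zero M (hT b hb k hk), zero_mul]
        · rw [ih b hb, mul_zero]
      simp [this, ih k hk]
    · simp [hkl, ih k hk]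

lemma Cl.compl {T : Set B} (hT : Cl M T) : Cl M Tᶜ := by
  intro i hi k hk
  rw [M.symmetric]
  exact hT k (by simpa using hk) i hi

/-- equal reflections have proportional roots -/
lemma root_unique {v w : W} {i k : B}
    (h : v * cs.simple i * v⁻¹ = w * cs.simple k * w⁻¹) :
    rep cs v (e i) = rep cs w (e k) ∨ rep cs v (e i) = - rep cs w (e k) := by
  have h1 := congrArg (fun g => rep cs g (rep cs v (e i))) h
  simp only [rep_refl, fm_root] at h1
  set γ := rep cs v (e i) with hγ
  set δ := rep cs w (e k) with hδ
  have h2 : γ = fm M δ γ • δ := by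
    have : (2 : ℝ) • γ = (2 : ℝ) • (fm M δ γ • δ) := by
      have h3 : γ - (2 * (1:ℝ)) • γ = γ - (2:ℝ) • (fm M δ γ • δ) := by rw [h1, smul_smul]
      have h4 := sub_right_injective h3
      simpa using h4
    exact smul_right_injective _ (two_ne_zero) this
  have h3 : fm M γ γ = 1 := fm_root cs v i
  have h4 : fm M δ δ = 1 := fm_root cs w k
  set c := fm M δ γ
  rw [h2] at h3
  simp only [map_smul, LinearMap.smul_apply, h4, smul_eq_mul, mul_one] at h3
  rcases mul_self_eq_one_iff.mp h3 with hc | hc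
  · left; rw [h2, hc, one_smul]
  · right; rw [h2, hc, neg_one_smul]

end CoxRig

namespace CoxRig
open Real

section basic
variable {B : Type*} [Fintype B] [DecidableEq B]
variable {W : Type*} [Group W] [Finite W] {M : CoxeterMatrix B} (cs : CoxeterSystem M W)

/-- `K` is closed under passing to non-commuting reflections. -/
def IsCl (R K : W → Prop) : Prop :=
  ∀ t t', R t → R t' → t * t' ≠ t' * t → K t → K t'

lemma K_conj {K : W → Prop} (hK : IsCl cs.IsReflection K) (w : W) :
    ∀ {t : W}, cs.IsReflection t → K t → K (w * t * w⁻¹) := by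
  induction w using cs.simple_induction_left with
  | one => intro t _ h; simpa using h
  | mul_simple_left w k ih =>
    intro t ht hKt
    have h1 := ih ht hKt
    have h2 : cs.IsReflection (w * t * w⁻¹) := ht.conj w
    have e1 : cs.simple k * w * t * (cs.simple k * w)⁻¹ =
        cs.simple k * (w * t * w⁻¹) * cs.simple k := by
      simp [mul_assoc]
    rw [e1]
    generalize w * t * w⁻¹ = u at *
    by_cases hc : u * cs.simple k = cs.simple k * u
    · rw [← hc]; simpa using h1
    · have h3 : K (cs.simple k) := hK _ _ h2 (cs.isReflection_simple k) hc h1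
      refine hK (cs.simple k) _ (cs.isReflection_simple k) ?_ ?_ h3
      · have := h2.conj (cs.simple k)
        simpa using this
      · intro h
        apply hc
        simpa [mul_assoc] using h

lemma M_two_of_comm {i j : B} (hij : i ≠ j)
    (h : cs.simple i * cs.simple j = cs.simple j * cs.simple i) : M i j = 2 := by
  have h1 : (cs.simple i * cs.simple j) ^ 2 = 1 := by
    rw [pow_two]; nth_rw 2 [h]; simp [mul_assoc]
  have h2 := orderOf_dvd_of_pow_eq_one h1
  have h0 := M_ne_zero cs i j
  rw [order_simple cs h0] at h2
  have := M_ge_two M hij h0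
  have := Nat.le_of_dvd (by norm_num) h2
  omega

lemma comm_of_M_two {i j : B} (h : M i j = 2) :
    cs.simple i * cs.simple j = cs.simple j * cs.simple i := by
  have h1 := cs.simple_mul_simple_pow i j
  rw [h, pow_two] at h1
  have := mul_eq_one_iff_eq_inv.mp h1
  simpa using this

lemma Cl_of_K {K : W → Prop} (hK : IsCl cs.IsReflection K) : Cl M {i | K (cs.simple i)} := by
  intro i hi k hk
  have hne : k ≠ i := by rintro rfl; exact hk hi
  apply M_two_of_comm cs hne
  by_contra hc
  exact hk (hK _ _ (cs.isReflection_simple i) (cs.isReflection_simple k) (fun h => hc h.symm) hi)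

lemma exists_rho {W : Type*} [Group W] [Finite W] (cs : CoxeterSystem M W) :
    ∃ y : B → ℝ, ∀ i, fm M (e i) y = 1 := by
  let L : (B → ℝ) →ₗ[ℝ] (B → ℝ) := LinearMap.pi fun i => fm M (e i)
  have hinj : Function.Injective L := by
    rw [← LinearMap.ker_eq_bot, LinearMap.ker_eq_bot']
    intro x hx
    by_contra h0
    have h1 := fm_pos cs x h0
    have h2 : fm M x x = 0 := by
      nth_rw 1 [eq_sum_e x]
      rw [map_sum, LinearMap.sum_apply]
      apply Finset.sum_eq_zero
      intro i _
      have := congrFun hx i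
      simp only [L, LinearMap.pi_apply, Pi.zero_apply] at this
      simp [this]
    linarith
  obtain ⟨y, hy⟩ := LinearMap.injective_iff_surjective.mp hinj (fun _ => 1)
  exact ⟨y, fun i => congrFun hy i⟩

/-- Gram entries from orders -/
lemma gram_aux {a b : W} {u v : B → ℝ} (hu : fm M u u = 1) (hv : fm M v v = 1)
    (ha : ∀ x, rep cs a x = x - (2 * fm M u x) • u)
    (hb : ∀ x, rep cs b x = x - (2 * fm M v x) • v) (hab : a ≠ b)
    (ha2 : a * a = 1) (hb2 : b * b = 1) :
    (a * b = b * a → fm M u v = 0) ∧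
    (orderOf (a * b) = 3 → fm M u v ^ 2 = 1 / 4) ∧
    (orderOf (a * b) = 4 → fm M u v ^ 2 = 1 / 2) := by
  have hvu : fm M v u = fm M u v := fm_symm M v u
  set c := fm M u v with hc
  have hc1 : 1 - c ^ 2 ≠ 0 := by
    intro h
    have h0 : u - c • v = 0 := by
      by_contra hne
      have := fm_pos cs _ hne
      simp only [map_sub, map_smul, LinearMap.sub_apply, LinearMap.smul_apply, smul_eq_mul,
        hu, hv, ← hc, hvu] at this
      nlinarith
    have h1 : u = c • v := sub_eq_zero.mp h0
    apply hab
    apply rep_inj cs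
    refine LinearMap.ext fun x => ?_
    rw [ha, hb, h1]
    simp only [map_smul, LinearMap.smul_apply, smul_eq_mul, smul_smul]
    congr 2
    linear_combination (-2 * fm M v x) * h
  have hind : ∀ p q : ℝ, p • u + q • v = 0 → p = 0 ∧ q = 0 := by
    intro p q h
    have h1 : fm M u (p • u + q • v) = 0 := by rw [h]; simp
    have h2 : fm M v (p • u + q • v) = 0 := by rw [h]; simp
    simp only [map_add, map_smul, smul_eq_mul, hu, hv, ← hc, hvu] at h1 h2
    constructor
    · have : p * (1 - c ^ 2) = 0 := by linear_combination h1 - c * h2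
      exact (mul_eq_zero.mp this).resolve_right hc1
    · have : q * (1 - c ^ 2) = 0 := by linear_combination h2 - c * h1
      exact (mul_eq_zero.mp this).resolve_right hc1
  have hau : rep cs a u = (-1 : ℝ) • u := by rw [ha, hu]; module
  have hav : rep cs a v = v - (2 * c) • u := by rw [ha]
  have hbv : rep cs b v = (-1 : ℝ) • v := by rw [hb, hv]; module
  have hbu : rep cs b u = u - (2 * c) • v := by rw [hb, hvu]
  have hainv : a⁻¹ = a := inv_eq_of_mul_eq_one_left ha2
  have hbinv : b⁻¹ = b := inv_eq_of_mul_eq_one_left hb2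
  refine ⟨fun h => ?_, fun h => ?_, fun h => ?_⟩
  · have h1 := congrArg (fun g => rep cs g u) h
    simp only [rep_mul, hau, hav, hbu, hbv, map_sub, map_smul] at h1
    have h2 := hind (4 * c ^ 2) (-4 * c) (by
      rw [← sub_eq_zero] at h1
      rw [← h1]; module)
    linarith [h2.2]
  · have h3 : (a * b) ^ 3 = 1 := by rw [← h]; exact pow_orderOf_eq_one _
    have h4 : a * b * a = b * a * b := by
      have : a * b * a * (b * a * b) = 1 := by rw [← h3]; simp [pow_succ, mul_assoc]
      rw [mul_eq_one_iff_eq_inv] at this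
      rw [this]; simp [mul_assoc, hainv, hbinv]
    have h1 := congrArg (fun g => rep cs g u) h4
    simp only [rep_mul, hau, hav, hbu, hbv, map_sub, map_smul] at h1
    have h2 := hind (2 * (1 - 4 * c ^ 2)) (8 * c^3 - 2 * c) (by
      rw [← sub_eq_zero] at h1
      rw [← h1]; module)
    linarith [h2.1]
  · have h3 : (a * b) ^ 4 = 1 := by rw [← h]; exact pow_orderOf_eq_one _
    have h4 : a * b * (a * b) = b * a * (b * a) := by
      have : a * b * (a * b) * (a * b * (a * b)) = 1 := by rw [← h3]; simp [pow_succ, mul_assoc]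
      rw [mul_eq_one_iff_eq_inv] at this
      rw [this]; simp [mul_assoc, hainv, hbinv]
    have h1 := congrArg (fun g => rep cs g u) h4
    simp only [rep_mul, hau, hav, hbu, hbv, map_sub, map_smul] at h1
    have h2 := hind ((4 * c ^ 2 - 1) ^ 2 - 1) (8 * c - 16 * c^3) (by
      rw [← sub_eq_zero] at h1
      rw [← h1]; module)
    have h5 : c ≠ 0 := by
      intro hc0
      have hcomm : a * b = b * a := by
        apply rep_inj cs
        refine LinearMap.ext fun x => ?_
        rw [rep_mul, rep_mul, ha, hb, hb, ha]
        simp only [map_sub, map_smul, smul_eq_mul, hvu, ← hc, hc0]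
        module
      have h6 : (a * b) ^ 2 = 1 := by
        rw [pow_two]; nth_rw 2 [hcomm]
        rw [mul_assoc, ← mul_assoc b, hb2, one_mul, ha2]
      have := orderOf_dvd_of_pow_eq_one h6
      rw [h] at this
      norm_num at this
    have h7 : c * (1 - 2 * c ^ 2) = 0 := by linear_combination h2.2 / 8
    have := (mul_eq_zero.mp h7).resolve_left h5
    linarith

lemma exists_leaf {W : Type*} [Group W] [Finite W] (cs : CoxeterSystem M W)
    (T : Finset B) (hT : T.Nonempty) :
    ∃ j ∈ T, ∀ k ∈ T, ∀ l ∈ T, k ≠ j → l ≠ j → gr M j k ≠ 0 → gr M j l ≠ 0 → k = l := by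
  by_contra hcon
  push Not at hcon
  let x : B → ℝ := fun i => if i ∈ T then 1 else 0
  have hx : x ≠ 0 := by
    obtain ⟨j, hj⟩ := hT
    intro h; have := congrFun h j; simp [x, hj] at this
  have hpos := fm_pos cs x hx
  have : fm M x x ≤ 0 := by
    rw [fm_apply]
    apply Finset.sum_nonpos
    intro j _
    by_cases hj : j ∈ T
    · obtain ⟨k, hk, l, hl, hkj, hlj, hgk, hgl, hkl⟩ := hcon j hj
      have h1 : ∑ b, x j * gr M j b * x b = ∑ b ∈ T, gr M j b := by
        simp [x, hj, Finset.sum_ite_mem]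
      rw [h1]
      have hsub : ({j, k, l} : Finset B) ⊆ T := by
        intro b hb; simp at hb; rcases hb with rfl | rfl | rfl <;> assumption
      rw [← Finset.sum_sdiff hsub]
      have h2 : ∑ b ∈ T \ {j, k, l}, gr M j b ≤ 0 := by
        apply Finset.sum_nonpos
        intro b hb
        apply gr_nonpos
        rintro rfl; simp at hb
      have h3 : ∑ b ∈ ({j, k, l} : Finset B), gr M j b = 1 + (gr M j k + gr M j l) := by
        rw [Finset.sum_insert (by simp [hkj.symm, hlj.symm]), Finset.sum_insert (by simp [hkl]),
          Finset.sum_singleton, gr_self]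
      have h4 := gr_le_half M hkj.symm (fun h => hgk (gr_eq_zero M h))
      have h5 := gr_le_half M hlj.symm (fun h => hgl (gr_eq_zero M h))
      linarith
    · simp [x, hj]
  linarith

lemma exists_signs {W : Type*} [Group W] [Finite W] (cs : CoxeterSystem M W)
    (c : B → B → ℝ) (hc : ∀ i j, c i j = c j i) (T : Finset B)
    (h : ∀ i ∈ T, ∀ j ∈ T, i ≠ j → c i j ^ 2 = gr M i j ^ 2) :
    ∃ ε : B → ℝ, (∀ i, ε i ^ 2 = 1) ∧
      ∀ i ∈ T, ∀ j ∈ T, i ≠ j → ε i * ε j * c i j = gr M i j := by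
  induction hn : T.card generalizing T with
  | zero =>
    rw [Finset.card_eq_zero] at hn
    subst hn
    exact ⟨fun _ => 1, by simp, by simp⟩
  | succ n ih =>
    obtain ⟨j, hj, hleaf⟩ := exists_leaf cs T (Finset.card_pos.mp (by omega))
    obtain ⟨ε, h1, h2⟩ := ih (T.erase j) (fun i hi k hk => h i (Finset.mem_of_mem_erase hi) k
      (Finset.mem_of_mem_erase hk)) (by rw [Finset.card_erase_of_mem hj, hn]; rfl)
    obtain ⟨s, hs, hs2⟩ : ∃ s : ℝ, s ^ 2 = 1 ∧
        ∀ k ∈ T, k ≠ j → s * ε k * c j k = gr M j k := by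
      by_cases hex : ∃ k ∈ T, k ≠ j ∧ gr M j k ≠ 0
      · obtain ⟨k, hk, hkj, hg⟩ := hex
        have hsq := h j hj k hk hkj.symm
        obtain ⟨s, hs, hs2⟩ : ∃ s : ℝ, s ^ 2 = 1 ∧ s * ε k * c j k = gr M j k := by
          rcases sq_eq_sq_iff_eq_or_eq_neg.mp hsq with h3 | h3
          · exact ⟨ε k, h1 k, by rw [h3]; linear_combination gr M j k * h1 k⟩
          · exact ⟨-ε k, by rw [neg_sq]; exact h1 k, by
              rw [h3]; linear_combination gr M j k * h1 k⟩
        refine ⟨s, hs, fun l hl hlj => ?_⟩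
        by_cases hgl : gr M j l = 0
        · have := h j hj l hl hlj.symm
          rw [hgl] at this
          have : c j l = 0 := by simpa using this
          rw [hgl, this, mul_zero]
        · rw [← hleaf k hk l hl hkj hlj hg hgl]; exact hs2
      · push Not at hex
        refine ⟨1, by norm_num, fun l hl hlj => ?_⟩
        have hgl := hex l hl hlj
        have := h j hj l hl hlj.symm
        rw [hgl] at this
        have : c j l = 0 := by simpa using this
        rw [hgl, this, mul_zero]
    refine ⟨Function.update ε j s, ?_, ?_⟩
    · intro i
      by_cases hi : i = j
      · subst hi; simpa using hs
      · simpa [hi] using h1 i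
    · intro i hi k hk hik
      by_cases hij : i = j
      · subst hij
        simp only [Function.update_self, Function.update_of_ne hik.symm]
        exact hs2 k hk hik.symm
      · by_cases hkj : k = j
        · subst hkj
          simp only [Function.update_self, Function.update_of_ne hik]
          rw [mul_comm (ε i), hc, gr_symm]
          exact hs2 i hi hik
        · simp only [Function.update_of_ne hij, Function.update_of_ne hkj]
          exact h2 i (Finset.mem_erase.mpr ⟨hij, hi⟩) k (Finset.mem_erase.mpr ⟨hkj, hk⟩) hik

end basic

end CoxRig

namespace CoxRig
open Real

section two
variable {B : Type*} [Fintype B] [DecidableEq B] {B' : Type*} [Fintype B'] [DecidableEq B']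
variable {W : Type*} [Group W] [Finite W] {M : CoxeterMatrix B} (cs : CoxeterSystem M W)
variable {M' : CoxeterMatrix B'} (cs' : CoxeterSystem M' W)

/-- `β` is a choice of roots for the second system inside the first representation. -/
def IsBeta (β : B' → B → ℝ) : Prop :=
  ∀ j, ∃ w i, cs'.simple j = w * cs.simple i * w⁻¹ ∧ β j = rep cs w (e i)

lemma exists_beta (hR : ∀ w, cs.IsReflection w ↔ cs'.IsReflection w) :
    ∃ β, IsBeta cs cs' β := by
  have : ∀ j, ∃ w i, cs'.simple j = w * cs.simple i * w⁻¹ :=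
    fun j => (hR _).mpr (cs'.isReflection_simple j)
  choose w i h using this
  exact ⟨fun j => rep cs (w j) (e (i j)), fun j => ⟨w j, i j, h j, rfl⟩⟩

variable {cs cs'}

lemma IsBeta.norm {β : B' → B → ℝ} (hβ : IsBeta cs cs' β) (j : B') : fm M (β j) (β j) = 1 := by
  obtain ⟨w, i, -, h⟩ := hβ j
  rw [h]; exact fm_root cs w i

lemma IsBeta.act {β : B' → B → ℝ} (hβ : IsBeta cs cs' β) (j : B') (x : B → ℝ) :
    rep cs (cs'.simple j) x = x - (2 * fm M (β j) x) • β j := by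
  obtain ⟨w, i, h1, h⟩ := hβ j
  rw [h, h1]; exact rep_refl cs w i x

lemma IsBeta.root {β : B' → B → ℝ} (hβ : IsBeta cs cs' β) {j : B'} {i : B} {u v : W}
    (h : u * cs.simple i * u⁻¹ = v * cs'.simple j * v⁻¹) :
    rep cs u (e i) = rep cs v (β j) ∨ rep cs u (e i) = - rep cs v (β j) := by
  obtain ⟨w, k, h1, h2⟩ := hβ j
  have := root_unique cs (v := u) (w := v * w) (i := i) (k := k) (by
    rw [h, h1]; group)
  rw [h2, ← rep_mul]
  exact this

lemma IsBeta.orth {β : B' → B → ℝ} (hβ : IsBeta cs cs' β) {K : W → Prop}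
    (hK : IsCl cs'.IsReflection K) {j k : B'} (hj : K (cs'.simple j)) (hk : ¬ K (cs'.simple k)) :
    fm M (β j) (β k) = 0 := by
  have hne : cs'.simple j ≠ cs'.simple k := by intro h; exact hk (h ▸ hj)
  refine (gram_aux cs (hβ.norm j) (hβ.norm k) (hβ.act j) (hβ.act k) hne (by simp) (by simp)).1 ?_
  by_contra hc
  exact hk (hK _ _ (cs'.isReflection_simple j) (cs'.isReflection_simple k) hc hj)

lemma exists_conj (hR : ∀ w, cs.IsReflection w ↔ cs'.IsReflection w) {K : W → Prop}
    (hK : IsCl cs.IsReflection K) {i : B} (hi : K (cs.simple i)) :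
    ∃ v j, K (cs'.simple j) ∧ cs.simple i = v * cs'.simple j * v⁻¹ := by
  obtain ⟨v, j, h⟩ := (hR _).mp (cs.isReflection_simple i)
  refine ⟨v, j, ?_, h⟩
  have := K_conj cs hK v⁻¹ (cs.isReflection_simple i) hi
  rw [h] at this
  simpa [mul_assoc] using this

lemma IsCl.congr (hR : ∀ w, cs.IsReflection w ↔ cs'.IsReflection w) {K : W → Prop}
    (hK : IsCl cs.IsReflection K) : IsCl cs'.IsReflection K :=
  fun t t' h h' => hK t t' ((hR _).mpr h) ((hR _).mpr h')

lemma card_le (hR : ∀ w, cs.IsReflection w ↔ cs'.IsReflection w) {K : W → Prop}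
    (hK : IsCl cs.IsReflection K) :
    Nat.card {i // K (cs.simple i)} ≤ Nat.card {j // K (cs'.simple j)} := by
  classical
  obtain ⟨β, hβ⟩ := exists_beta cs cs' hR
  let b : {j // K (cs'.simple j)} → B → ℝ := fun j => β j
  let N := Submodule.span ℝ (Set.range b)
  have hinv : ∀ v : W, ∀ x ∈ N, rep cs v x ∈ N := by
    intro v
    induction v using cs'.simple_induction_left with
    | one => intro x hx; simpa using hx
    | mul_simple_left w k ih =>
      intro x hx
      rw [rep_mul, hβ.act]
      have h1 := ih x hx
      by_cases hk : K (cs'.simple k)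
      · exact N.sub_mem h1 (N.smul_mem _ (Submodule.subset_span ⟨⟨k, hk⟩, rfl⟩))
      · have : fm M (β k) (rep cs w x) = 0 := by
          generalize rep cs w x = y at h1
          induction h1 using Submodule.span_induction with
          | mem y hy =>
            obtain ⟨j, rfl⟩ := hy
            rw [fm_symm]; exact hβ.orth (hK.congr hR) j.2 hk
          | zero => simp
          | add x y _ _ hx hy => simp [hx, hy]
          | smul a x _ hx => simp [hx]
        rw [this]; simpa using h1
  have hmem : ∀ i, K (cs.simple i) → e i ∈ N := by
    intro i hi
    obtain ⟨v, j, hj, h⟩ := exists_conj hR hK hi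
    have h3 := hinv v _ (Submodule.subset_span ⟨⟨j, hj⟩, rfl⟩ : b ⟨j, hj⟩ ∈ N)
    rcases hβ.root (u := 1) (by simpa using h) with h2 | h2 <;>
      simp only [map_one, Module.End.one_apply] at h2 <;> rw [h2]
    · exact h3
    · exact N.neg_mem h3
  have hli : LinearIndependent ℝ (fun i : {i // K (cs.simple i)} => (e i.1 : B → ℝ)) := by
    have := (Pi.basisFun ℝ B).linearIndependent.comp (fun i : {i // K (cs.simple i)} => i.1)
      Subtype.val_injective
    convert this using 2
    simp
  have h1 := linearIndependent_le_span' _ hli (Set.range b) (by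
    rintro _ ⟨i, rfl⟩; exact hmem i.1 i.2)
  rw [Cardinal.mk_fintype] at h1
  have h2 : Fintype.card (Set.range b) ≤ Fintype.card {j // K (cs'.simple j)} :=
    Fintype.card_range_le b
  have h3 : Fintype.card {i // K (cs.simple i)} ≤ Fintype.card (Set.range b) := by
    exact_mod_cast h1
  rw [Nat.card_eq_fintype_card, Nat.card_eq_fintype_card]
  exact h3.trans h2

lemma card_eq (hR : ∀ w, cs.IsReflection w ↔ cs'.IsReflection w) {K : W → Prop}
    (hK : IsCl cs.IsReflection K) :
    Nat.card {i // K (cs.simple i)} = Nat.card {j // K (cs'.simple j)} :=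
  le_antisymm (card_le hR hK) (card_le (fun w => (hR w).symm) (hK.congr hR))

/-- conjugate simple reflections give matching entries -/
lemma M_eq_of_conj {i k : B} {j l : B'} {w : W} (h1 : cs'.simple j = w * cs.simple i * w⁻¹)
    (h2 : cs'.simple l = w * cs.simple k * w⁻¹) : M i k = M' j l := by
  rw [← order_simple cs (M_ne_zero cs i k), ← order_simple cs' (M_ne_zero cs' j l), h1, h2]
  have : w * cs.simple i * w⁻¹ * (w * cs.simple k * w⁻¹) =
      MulAut.conj w (cs.simple i * cs.simple k) := by simp [mul_assoc]
  rw [this]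
  exact (MulEquiv.orderOf_eq (MulAut.conj w) _).symm

end two
end CoxRig

namespace CoxRig
open Real

section good
variable {B : Type*} [Fintype B] [DecidableEq B] {B' : Type*} [Fintype B'] [DecidableEq B']
variable {W : Type*} [Group W] [Finite W] {M : CoxeterMatrix B} {cs : CoxeterSystem M W}
variable {M' : CoxeterMatrix B'} {cs' : CoxeterSystem M' W}

lemma gr_of (M : CoxeterMatrix B) {i j : B} {k : ℕ} (h : M i j = k) :
    gr M i j = -Real.cos (π / (k : ℝ)) := by
  rw [← h]; rfl

lemma good_beta (hR : ∀ w, cs.IsReflection w ↔ cs'.IsReflection w) {K : W → Prop}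
    (hK : IsCl cs.IsReflection K)
    (h4 : ∀ j k, K (cs'.simple j) → K (cs'.simple k) → M' j k ≤ 4) :
    ∃ β : B' → B → ℝ, (∀ j, fm M (β j) (β j) = 1) ∧
      (∀ j x, rep cs (cs'.simple j) x = x - (2 * fm M (β j) x) • β j) ∧
      (∀ j k, K (cs'.simple k) → fm M (β j) (β k) = gr M' j k) ∧
      (∀ j i u v, u * cs.simple i * u⁻¹ = v * cs'.simple j * v⁻¹ →
        rep cs u (e i) = rep cs v (β j) ∨ rep cs u (e i) = - rep cs v (β j)) ∧
      (∀ j v, 0 ≤ rep cs v (β j) ∨ rep cs v (β j) ≤ 0) := by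
  classical
  obtain ⟨β, hβ⟩ := exists_beta cs cs' hR
  have hK' := hK.congr hR
  obtain ⟨ε, h1, h2⟩ := exists_signs cs' (fun j k => fm M (β j) (β k)) (fun j k => fm_symm M _ _)
    (Finset.univ.filter fun j => K (cs'.simple j)) (by
      intro j hj k hk hjk
      simp only [Finset.mem_filter, Finset.mem_univ, true_and] at hj hk
      have h0 := M_ne_zero cs' j k
      have hge := M_ge_two M' hjk h0
      have hle := h4 j k hj hk
      have hg := gram_aux cs (hβ.norm j) (hβ.norm k) (hβ.act j) (hβ.act k) (simple_ne cs' hjk)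
        (by simp) (by simp)
      rw [order_simple cs' h0] at hg
      have hm : M' j k = 2 ∨ M' j k = 3 ∨ M' j k = 4 := by omega
      rcases hm with hm | hm | hm
      · simp only [hg.1 (comm_of_M_two cs' hm), gr_eq_zero M' hm]
      · simp only [hg.2.1 hm, gr_of M' hm]; norm_num
      · simp only [hg.2.2 hm, gr_of M' hm]
        have := Real.cos_pi_div_four
        push_cast
        rw [this, neg_sq, div_pow]; norm_num)
  have hε : ∀ j, ε j = 1 ∨ ε j = -1 := fun j => by simpa using h1 j
  have hs : ∀ j, ε j • β j = β j ∨ ε j • β j = - β j := fun j => by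
    rcases hε j with h | h <;> simp [h]
  refine ⟨fun j => ε j • β j, ?_, ?_, ?_, ?_, ?_⟩
  · intro j
    simp only [map_smul, LinearMap.smul_apply, smul_eq_mul, hβ.norm]
    linear_combination h1 j
  · intro j x
    rw [hβ.act]
    simp only [map_smul, LinearMap.smul_apply, smul_eq_mul, smul_smul]
    congr 2
    linear_combination (-2 * fm M (β j) x) * h1 j
  · intro j k hk
    simp only [map_smul, LinearMap.smul_apply, smul_eq_mul]
    by_cases hj : K (cs'.simple j)
    · by_cases hjk : j = k
      · subst hjk
        rw [gr_self, hβ.norm]; linear_combination h1 j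
      · rw [← h2 j (by simpa using hj) k (by simpa using hk) hjk]; ring
    · rw [fm_symm, hβ.orth hK' hk hj, gr_eq_zero M' (Cl_of_K cs' hK' k hk j hj)]; ring
  · intro j i u v h
    have := hβ.root h
    rcases hs j with h' | h' <;> simp only [h', map_neg, neg_neg] <;> tauto
  · intro j v
    obtain ⟨w, i, -, h⟩ := hβ j
    have := root_pos_or_neg cs (v * w) i
    rw [rep_mul, ← h] at this
    rcases hs j with h' | h' <;> simp only [h', map_neg, Left.nonneg_neg_iff, Left.neg_nonpos_iff]
      <;> tauto

lemma good_case (hR : ∀ w, cs.IsReflection w ↔ cs'.IsReflection w) {K : W → Prop}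
    (hK : IsCl cs.IsReflection K)
    (h4 : ∀ j k, K (cs'.simple j) → K (cs'.simple k) → M' j k ≤ 4) :
    ∃ ψ : {i // K (cs.simple i)} ≃ {j // K (cs'.simple j)},
      ∀ a b : {i // K (cs.simple i)}, M a b = M' (ψ a) (ψ b) := by
  classical
  obtain ⟨β, hnorm, hact, hgram, hroot, hsign⟩ := good_beta hR hK h4
  have hK' := hK.congr hR
  let γ : B' → B → ℝ := fun j => if K (cs'.simple j) then β j else 0
  have hγ1 : ∀ {j}, K (cs'.simple j) → γ j = β j := fun h => if_pos h
  have hγ0 : ∀ {j}, ¬ K (cs'.simple j) → γ j = 0 := fun h => if_neg h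
  let f : (B' → ℝ) →ₗ[ℝ] (B → ℝ) := Fintype.linearCombination ℝ γ
  have hf : ∀ x, f x = ∑ j, x j • γ j := fun x => Fintype.linearCombination_apply ℝ γ x
  have hfe : ∀ j, f (e j) = γ j := fun j => by
    rw [hf]; simp [e, Pi.single_apply]
  have hbf1 : ∀ j, K (cs'.simple j) → ∀ x, fm M (β j) (f x) = fm M' (e j) x := by
    intro j hj x
    rw [hf, map_sum, fm_e_left]
    refine Finset.sum_congr rfl fun k _ => ?_
    rw [map_smul, smul_eq_mul]
    by_cases hk : K (cs'.simple k)
    · rw [hγ1 hk, hgram j k hk]; ring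
    · rw [hγ0 hk, gr_symm, gr_eq_zero M' (Cl_of_K cs' hK' j hj k hk)]; simp
  have hbf0 : ∀ j, ¬ K (cs'.simple j) → ∀ x, fm M (β j) (f x) = 0 := by
    intro j hj x
    rw [hf, map_sum]
    refine Finset.sum_eq_zero fun k _ => ?_
    rw [map_smul, smul_eq_mul]
    by_cases hk : K (cs'.simple k)
    · rw [hγ1 hk, hgram j k hk, gr_eq_zero M' (Cl_of_K cs' hK' k hk j hj)]; ring
    · rw [hγ0 hk]; simp
  have hequiv : ∀ w x, f (rep cs' w x) = rep cs w (f x) := by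
    intro w
    induction w using cs'.simple_induction_left with
    | one => intro x; simp
    | mul_simple_left w j ih =>
      intro x
      rw [rep_mul, rep_mul, rep_simple_apply, map_sub, map_smul, ih, hact, hfe, ← ih]
      by_cases hj : K (cs'.simple j)
      · rw [hγ1 hj, hbf1 j hj]
      · rw [hγ0 hj, hbf0 j hj]; simp
  obtain ⟨y, hy⟩ := exists_rho cs'
  obtain ⟨ρ, hρ⟩ := exists_rho cs
  let φ : (B → ℝ) →ₗ[ℝ] ℝ := fm M (f y)
  have hφ : ∀ j, K (cs'.simple j) → φ (β j) = 1 := fun j hj => by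
    change fm M (f y) (β j) = 1
    rw [fm_symm, hbf1 j hj, hy]
  obtain ⟨w, hw⟩ := Finite.exists_max (fun w : W => φ (rep cs w ρ))
  have hpos : ∀ i, 0 ≤ φ (rep cs w (e i)) := by
    intro i
    have := hw (w * cs.simple i)
    simp only [rep_mul, rep_simple_apply, hρ, map_sub, map_smul, smul_eq_mul] at this
    linarith
  have h5 : ∀ i, K (cs.simple i) → ∃ z : B' → ℝ, 0 ≤ z ∧ rep cs w (e i) = f z := by
    intro i hi
    obtain ⟨v, j, hj, h⟩ := exists_conj hR hK hi
    have h1 := hroot j i w (w * v) (by rw [h]; group)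
    have h2 : rep cs (w * v) (β j) = f (rep cs' (w * v) (e j)) := by rw [hequiv, hfe, hγ1 hj]
    obtain ⟨z, hz, hz2⟩ : ∃ z, (0 ≤ z ∨ z ≤ 0) ∧ rep cs w (e i) = f z := by
      have h3 := root_pos_or_neg cs' (w * v) j
      rcases h1 with h1 | h1
      · exact ⟨_, h3, by rw [h1, h2]⟩
      · exact ⟨- rep cs' (w * v) (e j), by
          simp only [Left.nonneg_neg_iff, Left.neg_nonpos_iff]; tauto, by rw [h1, h2, map_neg]⟩
    rcases hz with hz | hz
    · exact ⟨z, hz, hz2⟩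
    · refine ⟨0, le_rfl, ?_⟩
      have h6 := hpos i
      rw [hz2, hf, map_sum] at h6
      have h7 : ∀ k ∈ Finset.univ, φ (z k • γ k) ≤ 0 := by
        intro k _
        rw [map_smul, smul_eq_mul]
        by_cases hk : K (cs'.simple k)
        · rw [hγ1 hk, hφ k hk]; simpa using hz k
        · rw [hγ0 hk]; simp
      have h8 := (Finset.sum_eq_zero_iff_of_nonpos h7).mp (le_antisymm (Finset.sum_nonpos h7) h6)
      rw [hz2, map_zero, hf]
      refine Finset.sum_eq_zero fun k hk' => ?_
      by_cases hk : K (cs'.simple k)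
      · have := h8 k hk'
        rw [map_smul, smul_eq_mul, hγ1 hk, hφ k hk, mul_one] at this
        rw [this, zero_smul]
      · rw [hγ0 hk, smul_zero]
  have h6 : ∀ j, K (cs'.simple j) → 0 ≤ rep cs w⁻¹ (β j) := by
    intro j hj
    rcases hsign j w⁻¹ with h | h
    · exact h
    · exfalso
      have h1 : β j = rep cs w (rep cs w⁻¹ (β j)) := by rw [rep_self_inv]
      have h2 := hφ j hj
      rw [h1] at h2
      generalize rep cs w⁻¹ (β j) = x at h h2
      rw [eq_sum_e x] at h2
      simp only [map_sum, map_smul, smul_eq_mul] at h2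
      have : ∑ i, x i * φ (rep cs w (e i)) ≤ 0 :=
        Finset.sum_nonpos fun i _ => mul_nonpos_of_nonpos_of_nonneg (h i) (hpos i)
      linarith
  have h7 : ∀ i : {i // K (cs.simple i)}, ∃ j : {j // K (cs'.simple j)},
      cs'.simple j = w * cs.simple i * w⁻¹ := by
    rintro ⟨i, hi⟩
    obtain ⟨z, hz, hz2⟩ := h5 i hi
    have h1 : (e i : B → ℝ) = ∑ k, z k • rep cs w⁻¹ (γ k) := by
      have : rep cs w⁻¹ (rep cs w (e i)) = e i := by rw [rep_inv_self]
      rw [← this, hz2, hf]; simp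
    have hnn : ∀ l, ∀ k ∈ Finset.univ, 0 ≤ z k * rep cs w⁻¹ (γ k) l := by
      intro l k _
      by_cases hk : K (cs'.simple k)
      · rw [hγ1 hk]; exact mul_nonneg (hz k) (h6 k hk l)
      · rw [hγ0 hk]; simp
    have h2 : ∃ k, z k * rep cs w⁻¹ (γ k) i ≠ 0 := by
      by_contra hcon
      push Not at hcon
      have := congrFun h1 i
      simp [hcon] at this
    obtain ⟨k, hk⟩ := h2
    have hKk : K (cs'.simple k) := by
      by_contra hc
      rw [hγ0 hc] at hk; simp at hk
    have h3 : ∀ l, l ≠ i → rep cs w⁻¹ (β k) l = 0 := by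
      intro l hl
      have h8 := congrFun h1 l
      simp only [Finset.sum_apply, Pi.smul_apply, smul_eq_mul, e, Pi.single_apply, if_neg hl] at h8
      have := (Finset.sum_eq_zero_iff_of_nonneg (hnn l)).mp h8.symm k (Finset.mem_univ _)
      rw [hγ1 hKk] at this
      exact (mul_eq_zero.mp this).resolve_left (left_ne_zero_of_mul hk)
    have h9 : rep cs w⁻¹ (β k) = (rep cs w⁻¹ (β k) i) • e i := by
      ext l
      by_cases hl : l = i
      · subst hl; simp
      · rw [h3 l hl]; simp [hl]
    generalize rep cs w⁻¹ (β k) i = c at h9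
    have hc : c ^ 2 = 1 := by
      have := hnorm k
      rw [← fm_rep cs w⁻¹, h9] at this
      simp only [map_smul, LinearMap.smul_apply, smul_eq_mul, fm_e, gr_self] at this
      linear_combination this
    have h10 : β k = c • rep cs w (e i) := by
      rw [← map_smul, ← h9, rep_self_inv]
    refine ⟨⟨k, hKk⟩, ?_⟩
    apply rep_inj cs
    refine LinearMap.ext fun x => ?_
    rw [hact, rep_refl, h10]
    simp only [map_smul, LinearMap.smul_apply, smul_eq_mul, smul_smul]
    congr 2
    linear_combination (2 * fm M (rep cs w (e i)) x) * hc
  choose ψ hψ using h7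
  have hinj : Function.Injective ψ := by
    intro a b hab
    have h1 := hψ a
    rw [hab, hψ b] at h1
    have h2 : cs.simple b = cs.simple a := by simpa using h1
    by_contra hne
    exact simple_ne cs (fun h => hne (Subtype.ext h.symm)) h2
  have hbij := hinj.bijective_of_nat_card_le (card_eq hR hK).ge
  exact ⟨Equiv.ofBijective ψ hbij, fun a b => M_eq_of_conj (hψ a) (hψ b)⟩

end good
end CoxRig

namespace CoxRig
open Real

section conn
variable {B : Type*} [Fintype B] [DecidableEq B]
variable {W : Type*} [Group W] [Finite W] {M : CoxeterMatrix B} (cs : CoxeterSystem M W)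

/-- non-commuting reflections -/
def Rel (R : W → Prop) (t t' : W) : Prop := R t ∧ R t' ∧ t * t' ≠ t' * t

lemma isCl_class (R : W → Prop) (q : Quot (Rel R)) : IsCl R (fun t => Quot.mk (Rel R) t = q) := by
  intro t t' h h' hc hq
  rw [← hq]
  exact (Quot.sound ⟨h, h', hc⟩).symm

lemma orth_of_supp {T : Set B} (hT : Cl M T) {u v : B → ℝ} (hu : ∀ k ∉ T, u k = 0)
    (hv : ∀ k ∈ T, v k = 0) : fm M u v = 0 := by
  rw [fm_apply]
  refine Finset.sum_eq_zero fun i _ => Finset.sum_eq_zero fun j _ => ?_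
  by_cases hi : i ∈ T
  · by_cases hj : j ∈ T
    · rw [hv j hj, mul_zero]
    · rw [gr_symm, gr_eq_zero M (hT i hi j hj)]; ring
  · rw [hu i hi]; ring

lemma class_conn (R : W → Prop) (hR : R = cs.IsReflection) {T : Set B} (hT : Cl M T) {i k : B}
    (hi : i ∈ T) (h : Quot.mk (Rel R) (cs.simple i) = Quot.mk (Rel R) (cs.simple k)) : k ∈ T := by
  subst hR
  let D : W → Prop := fun t => ∃ w, ∃ i ∈ T, t = w * cs.simple i * w⁻¹
  have h1 : ∀ t t', Rel cs.IsReflection t t' → D t → D t' := by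
    rintro _ t' ⟨-, ⟨v, k, hk⟩, hc⟩ ⟨w, i, hi, rfl⟩
    by_cases hkT : k ∈ T
    · exact ⟨v, k, hkT, hk⟩
    · exfalso
      apply hc
      have hor : fm M (rep cs w (e i)) (rep cs v (e k)) = 0 := by
        apply orth_of_supp hT
        · exact supp cs hT w hi
        · intro l hl
          exact supp cs hT.compl v hkT l (by simpa using hl)
      have hor' : fm M (rep cs v (e k)) (rep cs w (e i)) = 0 := by rw [fm_symm, hor]
      apply rep_inj cs
      refine LinearMap.ext fun x => ?_
      rw [hk, rep_mul, rep_mul cs (v * cs.simple k * v⁻¹), rep_refl, rep_refl, rep_refl, rep_refl]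
      simp only [map_sub, map_smul, smul_eq_mul, hor, hor']
      module
  have hsymm : ∀ t t', Rel cs.IsReflection t t' → Rel cs.IsReflection t' t :=
    fun t t' h => ⟨h.2.1, h.1, fun hc => h.2.2 hc.symm⟩
  have h2 : D (cs.simple i) = D (cs.simple k) :=
    congrArg (Quot.lift D (fun t t' h => propext ⟨h1 t t' h, h1 t' t (hsymm t t' h)⟩)) h
  have h3 : D (cs.simple k) := by
    rw [← h2]; exact ⟨1, i, hi, by simp⟩
  obtain ⟨w, l, hl, h4⟩ := h3
  by_contra hk
  have h5 := root_unique cs (v := 1) (w := w) (i := k) (k := l) (by simpa using h4)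
  have h6 := supp cs hT w hl k hk
  simp only [map_one, Module.End.one_apply] at h5
  rcases h5 with h5 | h5
  · have := congrFun h5 k
    rw [h6] at this; simp at this
  · have := congrFun h5 k
    rw [Pi.neg_apply, h6] at this; simp at this

/-- connectivity of a set of vertices -/
def Conn (M : CoxeterMatrix B) (P : Set B) : Prop :=
  ∀ T ⊆ P, T.Nonempty → T ≠ P → ∃ i ∈ T, ∃ k ∈ P, k ∉ T ∧ M i k ≠ 2

lemma conn_class (R : W → Prop) (hR : R = cs.IsReflection) (q : Quot (Rel R)) :
    Conn M {i | Quot.mk (Rel R) (cs.simple i) = q} := by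
  intro T hTP hne hTne
  by_contra hcon
  push Not at hcon
  have hCl : Cl M T := by
    intro i hi k hk
    by_cases hkP : Quot.mk (Rel R) (cs.simple k) = q
    · rw [M.symmetric]; exact hcon i hi k hkP hk
    · have := Cl_of_K cs (K := fun t => Quot.mk (Rel R) t = q) (by
        subst hR; exact isCl_class _ q)
      exact this i (hTP hi) k hkP
  apply hTne
  refine Set.Subset.antisymm hTP fun k hk => ?_
  obtain ⟨i, hi⟩ := hne
  exact class_conn cs R hR hCl hi ((hTP hi).trans hk.symm)

lemma pos_test {W : Type*} [Group W] [Finite W] (cs : CoxeterSystem M W)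
    {n : ℕ} (g : Fin n → B) (hg : Function.Injective g) (x : Fin n → ℝ)
    (hx : ∃ a, x a ≠ 0) : 0 < ∑ a, ∑ b, x a * gr M (g a) (g b) * x b := by
  have h1 : (∑ a, x a • e (g a) : B → ℝ) ≠ 0 := by
    intro h
    obtain ⟨a, ha⟩ := hx
    have := congrFun h (g a)
    simp [Finset.sum_apply, Pi.single_apply, hg.eq_iff] at this
    exact ha this
  have h2 := fm_pos cs _ h1
  simp only [map_sum, LinearMap.sum_apply, map_smul, LinearMap.smul_apply, smul_eq_mul, fm_e] at h2
  simp only [Finset.mul_sum] at h2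
  convert h2 using 3 with a _ b _
  rw [gr_symm]; ring

lemma pos3 {W : Type*} [Group W] [Finite W] (cs : CoxeterSystem M W)
    {a b c : B} (hab : a ≠ b) (hac : a ≠ c) (hbc : b ≠ c) (x y z : ℝ) (hx : x ≠ 0) :
    0 < x ^ 2 + y ^ 2 + z ^ 2 + 2 * x * y * gr M a b + 2 * x * z * gr M a c
      + 2 * y * z * gr M b c := by
  have := pos_test cs ![a, b, c] (by
    intro i j; fin_cases i <;> fin_cases j <;>
      simp [hab, hac, hbc, hab.symm, hac.symm, hbc.symm]) ![x, y, z] ⟨0, by simpa using hx⟩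
  simp [Fin.sum_univ_succ, gr_self] at this
  rw [gr_symm M b a, gr_symm M c a, gr_symm M c b] at this
  linarith

lemma pos4 {W : Type*} [Group W] [Finite W] (cs : CoxeterSystem M W)
    {a b c d : B} (hab : a ≠ b) (hac : a ≠ c) (had : a ≠ d) (hbc : b ≠ c) (hbd : b ≠ d)
    (hcd : c ≠ d) (x y z u : ℝ) (hx : x ≠ 0) :
    0 < x ^ 2 + y ^ 2 + z ^ 2 + u ^ 2 + 2 * x * y * gr M a b + 2 * x * z * gr M a c
      + 2 * x * u * gr M a d + 2 * y * z * gr M b c + 2 * y * u * gr M b d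
      + 2 * z * u * gr M c d := by
  have := pos_test cs ![a, b, c, d] (by
    intro i j; fin_cases i <;> fin_cases j <;>
      simp [hab, hac, hbc, hab.symm, hac.symm, hbc.symm, had, hbd, hcd, had.symm, hbd.symm,
        hcd.symm]) ![x, y, z, u] ⟨0, by simpa using hx⟩
  simp [Fin.sum_univ_succ, gr_self] at this
  rw [gr_symm M b a, gr_symm M c a, gr_symm M c b, gr_symm M d a, gr_symm M d b,
    gr_symm M d c] at this
  linarith

lemma pos5 {W : Type*} [Group W] [Finite W] (cs : CoxeterSystem M W)
    {a b c d f : B} (hab : a ≠ b) (hac : a ≠ c) (had : a ≠ d) (haf : a ≠ f) (hbc : b ≠ c)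
    (hbd : b ≠ d) (hbf : b ≠ f) (hcd : c ≠ d) (hcf : c ≠ f) (hdf : d ≠ f)
    (x y z u v : ℝ) (hx : x ≠ 0) :
    0 < x ^ 2 + y ^ 2 + z ^ 2 + u ^ 2 + v ^ 2 + 2 * x * y * gr M a b + 2 * x * z * gr M a c
      + 2 * x * u * gr M a d + 2 * x * v * gr M a f
      + 2 * y * z * gr M b c + 2 * y * u * gr M b d + 2 * y * v * gr M b f
      + 2 * z * u * gr M c d + 2 * z * v * gr M c f + 2 * u * v * gr M d f := by
  have := pos_test cs ![a, b, c, d, f] (by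
    intro i j; fin_cases i <;> fin_cases j <;>
      simp [hab, hac, hbc, hab.symm, hac.symm, hbc.symm, had, hbd, hcd, had.symm, hbd.symm,
        hcd.symm, haf, hbf, hcf, hdf, haf.symm, hbf.symm, hcf.symm, hdf.symm])
      ![x, y, z, u, v] ⟨0, by simpa using hx⟩
  simp [Fin.sum_univ_succ, gr_self] at this
  rw [gr_symm M b a, gr_symm M c a, gr_symm M c b, gr_symm M d a, gr_symm M d b,
    gr_symm M d c, gr_symm M f a, gr_symm M f b, gr_symm M f c, gr_symm M f d] at this
  linarith

lemma gr4 {a b : B} (h : 4 ≤ M a b) : gr M a b ≤ -(7 / 10) := by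
  have h1 := gr_le M (k := 4) (by norm_num) (Or.inl h)
  push_cast at h1
  rw [Real.cos_pi_div_four] at h1
  have : (1.4 : ℝ) ≤ √2 := Real.le_sqrt_of_sq_le (by norm_num)
  linarith

lemma gr5 {a b : B} (h : 5 ≤ M a b) : gr M a b ≤ -(4 / 5) := by
  have h1 := gr_le M (k := 5) (by norm_num) (Or.inl h)
  push_cast at h1
  rw [Real.cos_pi_div_five] at h1
  have : (2.2 : ℝ) ≤ √5 := Real.le_sqrt_of_sq_le (by norm_num)
  linarith

lemma gr6 {a b : B} (h : 6 ≤ M a b) : gr M a b ≤ -(√3 / 2) := by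
  have h1 := gr_le M (k := 6) (by norm_num) (Or.inl h)
  push_cast at h1
  rwa [Real.cos_pi_div_six] at h1

lemma ex_tri {W : Type*} [Group W] [Finite W] (cs : CoxeterSystem M W)
    {a b c : B} (hab : a ≠ b) (hac : a ≠ c) (hbc : b ≠ c) (h1 : M a b ≠ 2)
    (h2 : M b c ≠ 2) : M a c = 2 := by
  by_contra h3
  have := pos3 cs hab hac hbc 1 1 1 one_ne_zero
  linarith [gr_le_half M hab h1, gr_le_half M hac h3, gr_le_half M hbc h2]

lemma ex_six {W : Type*} [Group W] [Finite W] (cs : CoxeterSystem M W)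
    {a b c : B} (hab : a ≠ b) (hac : a ≠ c) (hbc : b ≠ c) (h1 : 6 ≤ M a b)
    (h2 : M b c ≠ 2) : False := by
  have h3 : (√3) ^ 2 = 3 := Real.sq_sqrt (by norm_num)
  have h4 : 0 < √3 := by positivity
  have := pos3 cs hab hac hbc √3 2 1 h4.ne'
  have h5 := mul_le_mul_of_nonneg_left (gr6 h1) h4.le
  have h6 := mul_nonpos_of_nonneg_of_nonpos h4.le (gr_nonpos M hac)
  have h7 := gr_le_half M hbc h2
  nlinarith

lemma ex_54 {W : Type*} [Group W] [Finite W] (cs : CoxeterSystem M W)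
    {a b c : B} (hab : a ≠ b) (hac : a ≠ c) (hbc : b ≠ c) (h1 : 5 ≤ M a b)
    (h2 : 4 ≤ M b c) : False := by
  have := pos3 cs hab hac hbc 8 10 7 (by norm_num)
  linarith [gr5 h1, gr4 h2, gr_nonpos M hac]

lemma ex_star {W : Type*} [Group W] [Finite W] (cs : CoxeterSystem M W)
    {a b c d : B} (hab : a ≠ b) (hac : a ≠ c) (had : a ≠ d) (hbc : b ≠ c) (hbd : b ≠ d)
    (hcd : c ≠ d) (h1 : 5 ≤ M a b) (h2 : M b c ≠ 2) (h3 : M b d ≠ 2) : False := by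
  have := pos4 cs hab hac had hbc hbd hcd 3 4 2 2 (by norm_num)
  linarith [gr5 h1, gr_nonpos M hac, gr_nonpos M had, gr_nonpos M hcd, gr_le_half M hbc h2,
    gr_le_half M hbd h3]

lemma ex_353 {W : Type*} [Group W] [Finite W] (cs : CoxeterSystem M W)
    {a b c d : B} (hab : a ≠ b) (hac : a ≠ c) (had : a ≠ d) (hbc : b ≠ c) (hbd : b ≠ d)
    (hcd : c ≠ d) (h1 : 5 ≤ M a b) (h2 : M b c ≠ 2) (h3 : M a d ≠ 2) : False := by
  have := pos4 cs hab hac had hbc hbd hcd 2 2 1 1 (by norm_num)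
  linarith [gr5 h1, gr_nonpos M hac, gr_nonpos M hbd, gr_nonpos M hcd, gr_le_half M hbc h2,
    gr_le_half M had h3]

lemma ex_534 {W : Type*} [Group W] [Finite W] (cs : CoxeterSystem M W)
    {a b c d : B} (hab : a ≠ b) (hac : a ≠ c) (had : a ≠ d) (hbc : b ≠ c) (hbd : b ≠ d)
    (hcd : c ≠ d) (h1 : 5 ≤ M a b) (h2 : M b c ≠ 2) (h3 : 4 ≤ M c d) : False := by
  have := pos4 cs hab hac had hbc hbd hcd 3 4 4 3 (by norm_num)
  linarith [gr5 h1, gr_nonpos M hac, gr_nonpos M hbd, gr_nonpos M had, gr_le_half M hbc h2,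
    gr4 h3]

lemma ex_fork {W : Type*} [Group W] [Finite W] (cs : CoxeterSystem M W)
    {a b c d f : B} (hab : a ≠ b) (hac : a ≠ c) (had : a ≠ d) (haf : a ≠ f) (hbc : b ≠ c)
    (hbd : b ≠ d) (hbf : b ≠ f) (hcd : c ≠ d) (hcf : c ≠ f) (hdf : d ≠ f)
    (h1 : 5 ≤ M a b) (h2 : M b c ≠ 2) (h3 : M c d ≠ 2) (h4 : M c f ≠ 2) : False := by
  have := pos5 cs hab hac had haf hbc hbd hbf hcd hcf hdf 3 4 4 2 2 (by norm_num)
  linarith [gr5 h1, gr_le_half M hbc h2, gr_le_half M hcd h3, gr_le_half M hcf h4,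
    gr_nonpos M hac, gr_nonpos M had, gr_nonpos M haf, gr_nonpos M hbd, gr_nonpos M hbf,
    gr_nonpos M hdf]

lemma ex_H5 {W : Type*} [Group W] [Finite W] (cs : CoxeterSystem M W)
    {a b c d f : B} (hab : a ≠ b) (hac : a ≠ c) (had : a ≠ d) (haf : a ≠ f) (hbc : b ≠ c)
    (hbd : b ≠ d) (hbf : b ≠ f) (hcd : c ≠ d) (hcf : c ≠ f) (hdf : d ≠ f)
    (h1 : 5 ≤ M a b) (h2 : M b c ≠ 2) (h3 : M c d ≠ 2) (h4 : M d f ≠ 2) : False := by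
  have := pos5 cs hab hac had haf hbc hbd hbf hcd hcf hdf 16 20 15 10 5 (by norm_num)
  linarith [gr5 h1, gr_le_half M hbc h2, gr_le_half M hcd h3, gr_le_half M hdf h4,
    gr_nonpos M hac, gr_nonpos M had, gr_nonpos M haf, gr_nonpos M hbd, gr_nonpos M hbf,
    gr_nonpos M hcf]

end conn
end CoxRig

namespace CoxRig
open Real

/-- matrix of type H3 -/
def N3 : Matrix (Fin 3) (Fin 3) ℕ := !![1, 5, 2; 5, 1, 3; 2, 3, 1]
/-- matrix of type H4 -/
def N4 : Matrix (Fin 4) (Fin 4) ℕ := !![1, 5, 2, 2; 5, 1, 3, 2; 2, 3, 1, 3; 2, 2, 3, 1]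

section cls
variable {B : Type*} [Fintype B] [DecidableEq B] {M : CoxeterMatrix B}

lemma classify {W : Type*} [Group W] [Finite W] (cs : CoxeterSystem M W) {P : Set B}
    (hP : Conn M P) {a b : B} (ha : a ∈ P) (hb : b ∈ P) (h5 : 5 ≤ M a b) :
    (∃ g : Fin 2 → B, Function.Injective g ∧ Set.range g = P) ∨
    (∃ g : Fin 3 → B, Function.Injective g ∧ Set.range g = P ∧
      ∀ x y, M (g x) (g y) = N3 x y) ∨
    (∃ g : Fin 4 → B, Function.Injective g ∧ Set.range g = P ∧
      ∀ x y, M (g x) (g y) = N4 x y) := by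
  have hab : a ≠ b := by rintro rfl; simp at h5
  by_cases h2 : ({a, b} : Set B) = P
  · left
    refine ⟨![a, b], ?_, ?_⟩
    · intro i j; fin_cases i <;> fin_cases j <;> simp [hab, hab.symm]
    · rw [← h2]; ext x; simp [Fin.exists_fin_succ, eq_comm]; tauto
  right
  -- find the third vertex
  obtain ⟨a, b, c, ha, hb, hc, hab, hac, hbc, h5, hbc2⟩ : ∃ a b c, a ∈ P ∧ b ∈ P ∧ c ∈ P ∧
      a ≠ b ∧ a ≠ c ∧ b ≠ c ∧ 5 ≤ M a b ∧ M b c ≠ 2 := by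
    obtain ⟨i, hi, c, hc, hcT, hic⟩ := hP {a, b} (by
      intro x hx; rcases hx with rfl | rfl <;> assumption) ⟨a, by simp⟩ h2
    simp only [Set.mem_insert_iff, Set.mem_singleton_iff, not_or] at hi hcT
    rcases hi with rfl | rfl
    · exact ⟨b, i, c, hb, ha, hc, hab.symm, Ne.symm hcT.2, Ne.symm hcT.1,
        by rwa [M.symmetric], hic⟩
    · exact ⟨a, i, c, ha, hb, hc, hab, Ne.symm hcT.1, Ne.symm hcT.2, h5, hic⟩
  have h0 := M_ne_zero cs
  have mab : M a b = 5 := by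
    by_contra h
    exact ex_six cs hab hac hbc (by omega) hbc2
  have mbc : M b c = 3 := by
    have := M_ge_two M hbc (h0 b c)
    by_contra h
    exact ex_54 cs hab hac hbc h5 (by omega)
  have mac : M a c = 2 := ex_tri cs hab hac hbc (by omega) hbc2
  by_cases h3 : ({a, b, c} : Set B) = P
  · left
    refine ⟨![a, b, c], ?_, ?_, ?_⟩
    · intro i j; fin_cases i <;> fin_cases j <;>
        simp [hab, hab.symm, hac, hac.symm, hbc, hbc.symm]
    · rw [← h3]; ext x; simp [Fin.exists_fin_succ, eq_comm]; tauto
    · intro i j; fin_cases i <;> fin_cases j <;>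
        simp [N3, mab, mbc, mac, M.symmetric b a, M.symmetric c a, M.symmetric c b]
  right
  obtain ⟨i, hi, d, hd, hdT, hid⟩ := hP {a, b, c} (by
      intro x hx; rcases hx with rfl | rfl | rfl <;> assumption) ⟨a, by simp⟩ h3
  simp only [Set.mem_insert_iff, Set.mem_singleton_iff, not_or] at hi hdT
  obtain ⟨hda, hdb, hdc⟩ := hdT
  have mad : M a d = 2 := by
    by_contra h
    exact ex_353 cs hab hac (Ne.symm hda) hbc (Ne.symm hdb) (Ne.symm hdc) h5 hbc2 h
  have mbd : M b d = 2 := by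
    by_contra h
    exact ex_star cs hab hac (Ne.symm hda) hbc (Ne.symm hdb) (Ne.symm hdc) h5 hbc2 h
  have hcd2 : M c d ≠ 2 := by
    rcases hi with rfl | rfl | rfl
    · exact absurd mad hid
    · exact absurd mbd hid
    · exact hid
  have mcd : M c d = 3 := by
    have := M_ge_two M (Ne.symm hdc) (h0 c d)
    by_contra h
    exact ex_534 cs hab hac (Ne.symm hda) hbc (Ne.symm hdb) (Ne.symm hdc) h5 hbc2 (by omega)
  by_cases h4 : ({a, b, c, d} : Set B) = P
  · refine ⟨![a, b, c, d], ?_, ?_, ?_⟩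
    · intro i j; fin_cases i <;> fin_cases j <;>
        simp [hab, hab.symm, hac, hac.symm, hbc, hbc.symm, hda, hdb, hdc, Ne.symm hda,
          Ne.symm hdb, Ne.symm hdc]
    · rw [← h4]; ext x; simp [Fin.exists_fin_succ, eq_comm]; tauto
    · intro i j; fin_cases i <;> fin_cases j <;>
        simp [N4, mab, mbc, mac, mad, mbd, mcd, M.symmetric b a, M.symmetric c a, M.symmetric c b,
          M.symmetric d a, M.symmetric d b, M.symmetric d c]
  exfalso
  obtain ⟨i, hi, f, hf, hfT, hif⟩ := hP {a, b, c, d} (by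
      intro x hx; rcases hx with rfl | rfl | rfl | rfl <;> assumption) ⟨a, by simp⟩ h4
  simp only [Set.mem_insert_iff, Set.mem_singleton_iff, not_or] at hi hfT
  obtain ⟨hfa, hfb, hfc, hfd⟩ := hfT
  rcases hi with rfl | rfl | rfl | rfl
  · exact ex_353 cs hab hac (Ne.symm hfa) hbc (Ne.symm hfb) (Ne.symm hfc) h5 hbc2 hif
  · exact ex_star cs hab hac (Ne.symm hfa) hbc (Ne.symm hfb) (Ne.symm hfc) h5 hbc2 hif
  · exact ex_fork cs hab hac (Ne.symm hda) (Ne.symm hfa) hbc (Ne.symm hdb) (Ne.symm hfb)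
      (Ne.symm hdc) (Ne.symm hfc) (Ne.symm hfd) h5 hbc2 hcd2 hif
  · exact ex_H5 cs hab hac (Ne.symm hda) (Ne.symm hfa) hbc (Ne.symm hdb) (Ne.symm hfb)
      (Ne.symm hdc) (Ne.symm hfc) (Ne.symm hfd) h5 hbc2 hcd2 hif

end cls

section dih
variable {B : Type*} [Fintype B] [DecidableEq B] {B' : Type*} [Fintype B'] [DecidableEq B']
variable {W : Type*} [Group W] [Finite W] {M : CoxeterMatrix B} {cs : CoxeterSystem M W}
variable {M' : CoxeterMatrix B'} {cs' : CoxeterSystem M' W}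

lemma flip_zpow {x r : W} (h : x * r * x⁻¹ = r⁻¹) (z : ℤ) : r ^ z * x = x * r ^ (-z) := by
  have h1 : x * r ^ (-z) * x⁻¹ = r ^ z := by
    rw [← conj_zpow, h]; simp
  rw [← h1]; simp

lemma dih_form {K : W → Prop} (hK : IsCl cs.IsReflection K) {a b : B}
    (hKab : ∀ i, K (cs.simple i) ↔ i = a ∨ i = b) {t : W} (ht : cs.IsReflection t) (hKt : K t) :
    ∃ z : ℤ, t = cs.simple a * (cs.simple a * cs.simple b) ^ z := by
  obtain ⟨w, i, rfl⟩ := ht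
  have hi : i = a ∨ i = b := by
    rw [← hKab]
    have := K_conj cs hK w⁻¹ ((cs.isReflection_simple i).conj w) hKt
    simpa [mul_assoc] using this
  clear hKt
  set r := cs.simple a * cs.simple b with hr
  have hflip : ∀ z : ℤ, r ^ z * cs.simple a = cs.simple a * r ^ (-z) :=
    flip_zpow (by simp [hr, mul_assoc])
  have hb : cs.simple b = cs.simple a * r := by simp [hr]
  induction w using cs.simple_induction_left with
  | one =>
    rcases hi with rfl | rfl
    · exact ⟨0, by simp⟩
    · exact ⟨1, by simp [hb]⟩
  | mul_simple_left w k ih =>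
    obtain ⟨z, hz⟩ := ih
    have e1 : cs.simple k * w * cs.simple i * (cs.simple k * w)⁻¹ =
        cs.simple k * (w * cs.simple i * w⁻¹) * cs.simple k := by
      simp [mul_assoc]
    rw [e1, hz]
    by_cases hk : k = a ∨ k = b
    · rcases hk with rfl | rfl
      · exact ⟨-z, by rw [← hflip]; simp [mul_assoc]⟩
      · refine ⟨2 - z, ?_⟩
        have hb' : cs.simple k = r⁻¹ * cs.simple a := by simp [hr]
        calc cs.simple k * (cs.simple a * r ^ z) * cs.simple k
            = (r⁻¹ * cs.simple a) * (cs.simple a * r ^ z) * (cs.simple a * r) := by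
              rw [← hb, ← hb']
          _ = r⁻¹ * (r ^ z * cs.simple a) * r := by simp [mul_assoc]
          _ = (r ^ (-1 : ℤ) * cs.simple a) * r ^ (-z) * r := by rw [hflip z]; simp [mul_assoc]
          _ = _ := by
              rw [hflip, mul_assoc, mul_assoc, ← zpow_add_one, ← zpow_add]; congr 2; ring
    · have hck : ∀ l, l = a ∨ l = b → cs.simple k * cs.simple l = cs.simple l * cs.simple k := by
        intro l hl
        exact comm_of_M_two cs (Cl_of_K cs hK l ((hKab l).mpr hl) k (fun h => hk ((hKab k).mp h)))
      have h1 : Commute (cs.simple k) (cs.simple a) := hck a (Or.inl rfl)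
      have h2 : Commute (cs.simple k) (cs.simple b) := hck b (Or.inr rfl)
      have h3 : Commute (cs.simple k) (cs.simple a * r ^ z) :=
        h1.mul_right ((h1.mul_right h2).zpow_right z)
      refine ⟨z, ?_⟩
      rw [h3.eq]; simp

lemma dih_dvd (hR : ∀ w, cs.IsReflection w ↔ cs'.IsReflection w) {K : W → Prop}
    (hK : IsCl cs.IsReflection K) {a b : B} (hKab : ∀ i, K (cs.simple i) ↔ i = a ∨ i = b)
    {c d : B'} (hc : K (cs'.simple c)) (hd : K (cs'.simple d)) : M' c d ∣ M a b := by
  obtain ⟨y, hy⟩ := dih_form hK hKab ((hR _).mpr (cs'.isReflection_simple c)) hc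
  obtain ⟨z, hz⟩ := dih_form hK hKab ((hR _).mpr (cs'.isReflection_simple d)) hd
  have hflip := flip_zpow (x := cs.simple a) (r := cs.simple a * cs.simple b)
    (by simp [mul_assoc]) y
  rw [← order_simple cs' (M_ne_zero cs' c d)]
  apply orderOf_dvd_of_pow_eq_one
  have h1 : cs'.simple c * cs'.simple d = (cs.simple a * cs.simple b) ^ (z - y) := by
    rw [hy, hz, mul_assoc, ← mul_assoc _ (cs.simple a), hflip, mul_assoc, ← zpow_add]
    rw [← mul_assoc (cs.simple a) (cs.simple a)]
    simp only [CoxeterSystem.simple_mul_simple_self, one_mul]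
    congr 1; ring
  rw [h1, ← zpow_natCast, ← zpow_mul, mul_comm, zpow_mul, zpow_natCast, cs.simple_mul_simple_pow,
    one_zpow]

lemma glue {n : ℕ} {P : B → Prop} {P' : B' → Prop} (g : Fin n → B) (g' : Fin n → B')
    (hg : Function.Injective g) (hg' : Function.Injective g') (hr : Set.range g = {i | P i})
    (hr' : Set.range g' = {i | P' i}) (h : ∀ x y, M (g x) (g y) = M' (g' x) (g' y)) :
    ∃ ψ : {i // P i} ≃ {j // P' j}, ∀ a b : {i // P i}, M a b = M' (ψ a) (ψ b) := by
  let E : Fin n ≃ {i // P i} := (Equiv.ofInjective g hg).trans (Equiv.setCongr hr)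
  let E' : Fin n ≃ {i // P' i} := (Equiv.ofInjective g' hg').trans (Equiv.setCongr hr')
  have hE : ∀ x, (E x : B) = g x := fun x => rfl
  have hE' : ∀ x, (E' x : B') = g' x := fun x => rfl
  refine ⟨E.symm.trans E', fun a b => ?_⟩
  obtain ⟨x, rfl⟩ := E.surjective a
  obtain ⟨y, rfl⟩ := E.surjective b
  simp only [Equiv.trans_apply, Equiv.symm_apply_apply, hE, hE']
  exact h x y

lemma card_of_range {n : ℕ} {P : B → Prop} (g : Fin n → B)
    (hg : Function.Injective g) (hr : Set.range g = {i | P i}) : Nat.card {i // P i} = n := by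
  let E : Fin n ≃ {i // P i} := (Equiv.ofInjective g hg).trans (Equiv.setCongr hr)
  rw [Nat.card_congr E.symm]; simp

lemma bad_case (hR : ∀ w, cs.IsReflection w ↔ cs'.IsReflection w) {K : W → Prop}
    (hK : IsCl cs.IsReflection K) (hP : Conn M {i | K (cs.simple i)})
    (hP' : Conn M' {i | K (cs'.simple i)}) {a b : B} {a' b' : B'}
    (ha : K (cs.simple a)) (hb : K (cs.simple b)) (hab : 5 ≤ M a b)
    (ha' : K (cs'.simple a')) (hb' : K (cs'.simple b')) (hab' : 5 ≤ M' a' b') :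
    ∃ ψ : {i // K (cs.simple i)} ≃ {j // K (cs'.simple j)},
      ∀ a b : {i // K (cs.simple i)}, M a b = M' (ψ a) (ψ b) := by
  have hcard := card_eq hR hK
  rcases classify cs hP ha hb hab with ⟨g, h1, h2⟩ | ⟨g, h1, h2, h3⟩ | ⟨g, h1, h2, h3⟩ <;>
  rcases classify cs' hP' ha' hb' hab' with ⟨g', h1', h2'⟩ | ⟨g', h1', h2', h3'⟩ |
    ⟨g', h1', h2', h3'⟩ <;>
  rw [card_of_range g h1 h2, card_of_range g' h1' h2'] at hcard <;>
  first | (exfalso; revert hcard; norm_num; done) | skip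
  · have e1 : ∀ i, K (cs.simple i) ↔ i = g 0 ∨ i = g 1 := by
      intro i
      have : i ∈ Set.range g ↔ K (cs.simple i) := by rw [h2]; rfl
      rw [← this]; simp [Fin.exists_fin_two, eq_comm]
    have e2 : ∀ i, K (cs'.simple i) ↔ i = g' 0 ∨ i = g' 1 := by
      intro i
      have : i ∈ Set.range g' ↔ K (cs'.simple i) := by rw [h2']; rfl
      rw [← this]; simp [Fin.exists_fin_two, eq_comm]
    have hm : M (g 0) (g 1) = M' (g' 0) (g' 1) := by
      apply Nat.dvd_antisymm
      · exact dih_dvd (fun w => (hR w).symm) (hK.congr hR) e2 ((e1 _).mpr (Or.inl rfl))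
          ((e1 _).mpr (Or.inr rfl))
      · exact dih_dvd hR hK e1 ((e2 _).mpr (Or.inl rfl)) ((e2 _).mpr (Or.inr rfl))
    refine glue g g' h1 h1' h2 h2' ?_
    intro x y
    fin_cases x <;> fin_cases y
    · simp
    · exact hm
    · rw [M.symmetric, M'.symmetric]; exact hm
    · simp
  · exact glue g g' h1 h1' h2 h2' fun x y => by rw [h3, h3']
  · exact glue g g' h1 h1' h2 h2' fun x y => by rw [h3, h3']

lemma class_case (hR : ∀ w, cs.IsReflection w ↔ cs'.IsReflection w)
    (q : Quot (Rel cs.IsReflection)) :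
    ∃ ψ : {i // Quot.mk (Rel cs.IsReflection) (cs.simple i) = q} ≃
        {j // Quot.mk (Rel cs.IsReflection) (cs'.simple j) = q},
      ∀ a b : {i // Quot.mk (Rel cs.IsReflection) (cs.simple i) = q},
        M a b = M' (ψ a) (ψ b) := by
  have hK := isCl_class cs.IsReflection q
  by_cases h4' : ∀ j k, Quot.mk (Rel cs.IsReflection) (cs'.simple j) = q →
      Quot.mk (Rel cs.IsReflection) (cs'.simple k) = q → M' j k ≤ 4
  · exact good_case hR hK h4'
  by_cases h4 : ∀ j k, Quot.mk (Rel cs.IsReflection) (cs.simple j) = q →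
      Quot.mk (Rel cs.IsReflection) (cs.simple k) = q → M j k ≤ 4
  · obtain ⟨ψ, hψ⟩ := good_case (fun w => (hR w).symm) (hK.congr hR) h4
    refine ⟨ψ.symm, fun a b => ?_⟩
    rw [hψ]; simp
  push Not at h4 h4'
  obtain ⟨a, b, ha, hb, hab⟩ := h4
  obtain ⟨a', b', ha', hb', hab'⟩ := h4'
  exact bad_case hR hK (conn_class cs _ rfl q)
    (conn_class cs' _ (funext fun w => propext (hR w)) q) ha hb hab ha' hb' hab'

lemma main (hR : ∀ w, cs.IsReflection w ↔ cs'.IsReflection w) :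
    ∃ ψ : B ≃ B', ∀ i j : B, M i j = M' (ψ i) (ψ j) := by
  choose ψ hψ using class_case hR
  let p : B → Quot (Rel cs.IsReflection) := fun i => Quot.mk _ (cs.simple i)
  let p' : B' → Quot (Rel cs.IsReflection) := fun i => Quot.mk _ (cs'.simple i)
  let Ψ : B ≃ B' := (Equiv.sigmaFiberEquiv p).symm.trans
    ((Equiv.sigmaCongrRight ψ).trans (Equiv.sigmaFiberEquiv p'))
  have hΨ : ∀ i, Ψ i = (ψ (p i) ⟨i, rfl⟩ : B') := fun i => rfl
  have hp : ∀ i, p' (Ψ i) = p i := fun i => by rw [hΨ]; exact (ψ (p i) ⟨i, rfl⟩).2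
  refine ⟨Ψ, fun i j => ?_⟩
  by_cases hij : p j = p i
  · have h1 : (ψ (p j) ⟨j, rfl⟩ : B') = ψ (p i) ⟨j, hij⟩ := by
      have : ∀ q (h : p j = q), (ψ (p j) ⟨j, rfl⟩ : B') = ψ q ⟨j, h⟩ := by
        rintro q rfl; rfl
      exact this _ hij
    rw [hΨ, hΨ, h1]
    exact hψ (p i) ⟨i, rfl⟩ ⟨j, hij⟩
  · have hne : i ≠ j := by rintro rfl; exact hij rfl
    have hne' : Ψ i ≠ Ψ j := fun h => hne (Ψ.injective h)
    rw [M_two_of_comm cs hne, M_two_of_comm cs' hne']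
    · by_contra hc
      apply hij
      have : p' (Ψ i) = p' (Ψ j) := Quot.sound ⟨(hR _).mpr (cs'.isReflection_simple _),
        (hR _).mpr (cs'.isReflection_simple _), hc⟩
      rw [hp, hp] at this; exact this.symm
    · by_contra hc
      exact hij (Quot.sound ⟨cs.isReflection_simple _, cs.isReflection_simple _,
        fun h => hc h.symm⟩)

end dih
end CoxRig

/-- If `(W, S)` is a Coxeter system with `W` finite, then `(W, S)` is reflection rigid. -/
theorem reflectionRigid_of_finite {B W : Type*} [Group W] [Finite B] [Finite W]
    {M : CoxeterMatrix B} (cs : CoxeterSystem M W) :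
    cs.ReflectionRigid := by
  intro B' hB' M' cs' hR
  classical
  have := Fintype.ofFinite B
  have := Fintype.ofFinite B'
  exact CoxRig.main (cs := cs) (cs' := cs') hR
end
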